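/- Let n ≥ 3. A map Z : T_o^n → K_o^n is an SL(n) covariant Minkowski valuation if and only if there exist constants a₁, a₂, b₁, b₂, c₁, c₂ ≥ 0 satisfying a₁ ≤ a₂, b₁ ≤ b₂, a₂ − a₁ ≤ b₂ and b₂ − b₁ ≤ a₂ such that ZT = c₁·M⁺T + c₂·M⁻T + D_{a₁,a₂,b₁,b₂}T for every T ∈ T_o^n, where D_{a₁,a₂,b₁,b₂}T = [a₂v_i − b₂v_j, a₂v_i − (a₂−a₁)v_j, (b₂−b₁)v_i − b₂v_j : 1 ≤ i, j ≤ d] (convex hull) for T = [o, v₁, …, v_d] with 2 ≤ d ≤ n and o, v₁, …, v_d affinely independent, and D_{a₁,a₂,b₁,b₂}T = [−b₁v₁, a₁v₁] for T = [o, v₁]. -/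

import Mathlib

open scoped RealInnerProductSpace BigOperators Pointwise ENNReal
open MeasureTheory Filter Matrix

noncomputable section

/-- `Euc n` is Euclidean space `ℝ^n`. -/
abbrev Euc (n : ℕ) := EuclideanSpace ℝ (Fin n)

/-- A convex body in `ℝ^n` containing the origin: a nonempty compact convex set with `0 ∈ K`. -/
def IsConvexBody0 {n : ℕ} (K : Set (Euc n)) : Prop :=
  IsCompact K ∧ Convex ℝ K ∧ (0 : Euc n) ∈ K

/-- A convex polytope in `ℝ^n` containing the origin. -/
def IsPolytope0 {n : ℕ} (P : Set (Euc n)) : Prop :=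
  (∃ S : Finset (Euc n), P = convexHull ℝ (S : Set (Euc n))) ∧ (0 : Euc n) ∈ P

/-- The support function `h_K(x) = sup { ⟪x, y⟫ : y ∈ K }`. -/
def supp {n : ℕ} (K : Set (Euc n)) (x : Euc n) : ℝ :=
  sSup ((fun y => ⟪x, y⟫) '' K)

/-- The image of a set under the linear map induced by a matrix. -/
def matAct {n : ℕ} (A : Matrix (Fin n) (Fin n) ℝ) (K : Set (Euc n)) : Set (Euc n) :=
  (Matrix.toEuclideanLin A) '' K

/-- The vector `A x`. -/
def matVec {n : ℕ} (A : Matrix (Fin n) (Fin n) ℝ) (x : Euc n) : Euc n :=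
  Matrix.toEuclideanLin A x

/-- The dimension of a set: the dimension of (the direction of) its affine hull. -/
def sdim {n : ℕ} (P : Set (Euc n)) : ℕ :=
  Module.finrank ℝ (affineSpan ℝ P).direction

/-- Support function of the asymmetric moment body: `h_{M⁺K}(x) = ∫_K max(⟪x,y⟫,0) dy`. -/
def mPlus1 {n : ℕ} (K : Set (Euc n)) (x : Euc n) : ℝ :=
  ∫ y in K, max ⟪x, y⟫ 0

/-- Support function of the asymmetric moment body `M⁻`. -/
def mMinus1 {n : ℕ} (K : Set (Euc n)) (x : Euc n) : ℝ :=
  ∫ y in K, max (-⟪x, y⟫) 0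

/-- The simplex `[o, v 0, …, v (d-1)]`. -/
def simplexOf {n d : ℕ} (v : Fin d → Euc n) : Set (Euc n) :=
  convexHull ℝ (Set.range (Fin.cons (0 : Euc n) v : Fin (d + 1) → Euc n))

/-- A (nondegenerate) simplex having the origin as one of its vertices. -/
def IsSimplex0 {n : ℕ} (T : Set (Euc n)) : Prop :=
  ∃ (d : ℕ) (v : Fin d → Euc n), 1 ≤ d ∧
    AffineIndependent ℝ (Fin.cons (0 : Euc n) v : Fin (d + 1) → Euc n) ∧ T = simplexOf v

/-- The body `D_{a₁,a₂,b₁,b₂} T` for `T = [o,v₁,…,v_d]`, `d ≥ 2`: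
`[a₂ v_i - b₂ v_j, a₂ v_i - (a₂-a₁) v_j, (b₂-b₁) v_i - b₂ v_j : 1 ≤ i,j ≤ d]`. -/
def Dbody {n : ℕ} (a₁ a₂ b₁ b₂ : ℝ) {d : ℕ} (v : Fin d → Euc n) : Set (Euc n) :=
  convexHull ℝ {z : Euc n | ∃ i j : Fin d,
    z = a₂ • v i - b₂ • v j ∨ z = a₂ • v i - (a₂ - a₁) • v j ∨
      z = (b₂ - b₁) • v i - b₂ • v j}

/-! ### Support functions -/

section Supp

variable {n : ℕ} {K L : Set (Euc n)}

lemma bddAbove_inner_image (hK : IsCompact K) (x : Euc n) :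
    BddAbove ((fun y => ⟪x, y⟫) '' K) :=
  (hK.image (by fun_prop)).bddAbove

lemma inner_le_supp (hK : IsCompact K) (x : Euc n) {y : Euc n} (hy : y ∈ K) :
    ⟪x, y⟫ ≤ supp K x :=
  le_csSup (bddAbove_inner_image hK x) (Set.mem_image_of_mem _ hy)

lemma supp_le (hK : K.Nonempty) {x : Euc n} {c : ℝ} (h : ∀ y ∈ K, ⟪x, y⟫ ≤ c) :
    supp K x ≤ c :=
  csSup_le (hK.image _) (by rintro _ ⟨y, hy, rfl⟩; exact h y hy)

lemma supp_add_set (hK : IsCompact K) (hL : IsCompact L) (hK' : K.Nonempty) (hL' : L.Nonempty)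
    (x : Euc n) : supp (K + L) x = supp K x + supp L x := by
  unfold supp
  rw [← csSup_add (hK'.image _) (bddAbove_inner_image hK x) (hL'.image _)
    (bddAbove_inner_image hL x)]
  congr 1
  exact Set.image_add (innerₛₗ ℝ x)

lemma inner_toEuclideanLin (A : Matrix (Fin n) (Fin n) ℝ) (x y : Euc n) :
    ⟪x, Matrix.toEuclideanLin A y⟫ = ⟪Matrix.toEuclideanLin Aᵀ x, y⟫ := by
  rw [← LinearMap.adjoint_inner_left, ← Matrix.toEuclideanLin_conjTranspose_eq_adjoint,
    Matrix.conjTranspose_eq_transpose_of_trivial]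

lemma supp_matAct (A : Matrix (Fin n) (Fin n) ℝ) (x : Euc n) :
    supp (matAct A K) x = supp K (Matrix.toEuclideanLin Aᵀ x) := by
  unfold supp matAct
  simp only [Set.image_image, inner_toEuclideanLin]

lemma supp_add_le (hK : IsCompact K) (hK' : K.Nonempty) (x y : Euc n) :
    supp K (x + y) ≤ supp K x + supp K y :=
  supp_le hK' fun z hz => by
    rw [inner_add_left]
    exact add_le_add (inner_le_supp hK x hz) (inner_le_supp hK y hz)

lemma supp_smul (K : Set (Euc n)) {c : ℝ} (hc : 0 ≤ c) (x : Euc n) :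
    supp K (c • x) = c * supp K x := by
  unfold supp
  rw [← smul_eq_mul, ← Real.sSup_smul_of_nonneg hc]
  congr 1
  ext r
  simp [Set.mem_smul_set, inner_smul_left]

lemma supp_nonneg (hK : IsCompact K) (h0 : (0 : Euc n) ∈ K) (x : Euc n) : 0 ≤ supp K x := by
  simpa using inner_le_supp hK x h0

lemma continuous_supp (hK : IsCompact K) : Continuous (supp K) :=
  hK.continuous_sSup (f := fun x y : Euc n => ⟪x, y⟫) (by fun_prop)

lemma subset_of_supp_le (hL : IsCompact L) (hK : IsCompact K) (hKc : Convex ℝ K)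
    (hK' : K.Nonempty) (h : ∀ x, supp L x ≤ supp K x) : L ⊆ K := by
  intro y hy
  by_contra hyK
  obtain ⟨f, u, hu, hfy⟩ := geometric_hahn_banach_closed_point hKc hK.isClosed hyK
  set x := (InnerProductSpace.toDual ℝ (Euc n)).symm f with hx
  have hf : ∀ z, ⟪x, z⟫ = f z := fun z => InnerProductSpace.toDual_symm_apply
  have h1 : supp K x ≤ u := supp_le hK' fun z hz => by rw [hf]; exact (hu z hz).le
  have h2 := inner_le_supp hL x hy
  rw [hf] at h2
  linarith [h x]

lemma eq_of_supp_eq (hK : IsCompact K) (hL : IsCompact L) (hKc : Convex ℝ K) (hLc : Convex ℝ L)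
    (hK' : K.Nonempty) (hL' : L.Nonempty) (h : ∀ x, supp K x = supp L x) : K = L :=
  (subset_of_supp_le hK hL hLc hL' fun x => (h x).le).antisymm
    (subset_of_supp_le hL hK hKc hK' fun x => (h x).ge)

end Supp

/-! ### Simplices with a vertex at the origin -/

section Simplex

variable {n d : ℕ}

lemma affineIndependent_cons_zero_iff (v : Fin d → Euc n) :
    AffineIndependent ℝ (Fin.cons (0 : Euc n) v : Fin (d + 1) → Euc n) ↔
      LinearIndependent ℝ v := by
  rw [affineIndependent_iff_linearIndependent_vsub ℝ _ (0 : Fin (d + 1)),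
    ← linearIndependent_equiv (finSuccAboveEquiv (0 : Fin (d + 1)))]
  apply iff_of_eq
  congr 1
  ext i : 1
  simp [finSuccAboveEquiv_apply]

lemma simplexOf_eq (v : Fin d → Euc n) :
    simplexOf v = convexHull ℝ (insert 0 (Set.range v)) := by
  rw [simplexOf, Fin.range_cons]

lemma simplexOf_congr {d' : ℕ} {v : Fin d → Euc n} {w : Fin d' → Euc n}
    (h : Set.range v = Set.range w) : simplexOf v = simplexOf w := by
  rw [simplexOf_eq, simplexOf_eq, h]

lemma simplexOf_comp_perm (v : Fin d → Euc n) (σ : Equiv.Perm (Fin d)) :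
    simplexOf (v ∘ σ) = simplexOf v :=
  simplexOf_congr (σ.surjective.range_comp v)

lemma zero_mem_simplexOf (v : Fin d → Euc n) : (0 : Euc n) ∈ simplexOf v := by
  rw [simplexOf_eq]
  exact subset_convexHull _ _ (Set.mem_insert _ _)

lemma mem_simplexOf_self (v : Fin d → Euc n) (i : Fin d) : v i ∈ simplexOf v := by
  rw [simplexOf_eq]
  exact subset_convexHull _ _ (Set.mem_insert_of_mem _ ⟨i, rfl⟩)

lemma isCompact_simplexOf (v : Fin d → Euc n) : IsCompact (simplexOf v) :=
  (Set.finite_range _).isCompact_convexHull ℝ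

lemma convex_simplexOf (v : Fin d → Euc n) : Convex ℝ (simplexOf v) := convex_convexHull _ _

lemma mem_simplexOf {v : Fin d → Euc n} {y : Euc n} :
    y ∈ simplexOf v ↔ ∃ t : Fin d → ℝ, (∀ i, 0 ≤ t i) ∧ ∑ i, t i ≤ 1 ∧ y = ∑ i, t i • v i := by
  constructor
  · rw [simplexOf_eq]
    refine fun hy => convexHull_min (t := {y | ∃ t : Fin d → ℝ, (∀ i, 0 ≤ t i) ∧ ∑ i, t i ≤ 1 ∧
      y = ∑ i, t i • v i}) ?_ ?_ hy
    · rintro z (rfl | ⟨i, rfl⟩)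
      · exact ⟨0, by simp, by simp, by simp⟩
      · refine ⟨Pi.single i 1, fun j => ?_, ?_, ?_⟩
        · by_cases h : j = i
          · subst h; simp
          · simp [h]
        · simp
        · simp [Pi.single_apply, ite_smul]
    · rintro _ ⟨t, ht, ht1, rfl⟩ _ ⟨s, hs, hs1, rfl⟩ a b ha hb hab
      refine ⟨fun i => a * t i + b * s i, fun i => ?_, ?_, ?_⟩
      · have := ht i; have := hs i; positivity
      · rw [Finset.sum_add_distrib, ← Finset.mul_sum, ← Finset.mul_sum]
        nlinarith
      · simp [add_smul, mul_smul, Finset.sum_add_distrib, Finset.smul_sum]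
  · rintro ⟨t, ht, ht1, rfl⟩
    have h := (convex_simplexOf v).sum_mem (t := Finset.univ)
      (w := (Fin.cons (1 - ∑ i, t i) t : Fin (d + 1) → ℝ))
      (z := (Fin.cons (0 : Euc n) v : Fin (d + 1) → Euc n)) ?_ ?_ ?_
    · simpa [Fin.sum_univ_succ] using h
    · intro i _
      refine Fin.cases ?_ (fun j => ?_) i
      · simpa using ht1
      · simpa using ht j
    · simp [Fin.sum_univ_succ]
    · intro i _
      refine Fin.cases ?_ (fun j => ?_) i
      · simpa using zero_mem_simplexOf v
      · simpa using mem_simplexOf_self v j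

lemma matAct_simplexOf (A : Matrix (Fin n) (Fin n) ℝ) (v : Fin d → Euc n) :
    matAct A (simplexOf v) = simplexOf (fun i => Matrix.toEuclideanLin A (v i)) := by
  rw [matAct, simplexOf_eq, simplexOf_eq, LinearMap.image_convexHull, Set.image_insert_eq,
    map_zero, ← Set.range_comp]
  rfl

lemma isSimplex0_iff {T : Set (Euc n)} :
    IsSimplex0 T ↔ ∃ (d : ℕ) (v : Fin d → Euc n), 1 ≤ d ∧ LinearIndependent ℝ v ∧
      T = simplexOf v := by
  simp only [IsSimplex0, affineIndependent_cons_zero_iff]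

lemma LinearIndependent.isSimplex0 {v : Fin d → Euc n} (hv : LinearIndependent ℝ v)
    (hd : 1 ≤ d) : IsSimplex0 (simplexOf v) :=
  isSimplex0_iff.2 ⟨d, v, hd, hv, rfl⟩

lemma LinearIndependent.le_dim {v : Fin d → Euc n} (hv : LinearIndependent ℝ v) : d ≤ n := by
  simpa using hv.fintype_card_le_finrank

lemma exists_coordinates {v : Fin d → Euc n} (hv : LinearIndependent ℝ v) :
    ∃ g : Euc n →ₗ[ℝ] (Fin d → ℝ), ∀ t : Fin d → ℝ, g (∑ i, t i • v i) = t := by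
  obtain ⟨g, hg⟩ := LinearMap.exists_leftInverse_of_injective (Fintype.linearCombination ℝ v)
    (LinearMap.ker_eq_bot_of_injective hv.fintypeLinearCombination_injective)
  refine ⟨g, fun t => ?_⟩
  have := LinearMap.congr_fun hg t
  simpa [Fintype.linearCombination_apply] using this

lemma coordinates_apply_self {v : Fin d → Euc n} {g : Euc n →ₗ[ℝ] (Fin d → ℝ)}
    (hg : ∀ t : Fin d → ℝ, g (∑ i, t i • v i) = t) (i : Fin d) : g (v i) = Pi.single i 1 := by
  rw [← hg (Pi.single i 1)]
  simp [Pi.single_apply, ite_smul]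

end Simplex

/-! ### Cutting a simplex by hyperplanes through the origin -/

section Cut

variable {n d : ℕ}

lemma sum_update_smul {M : Type*} [AddCommGroup M] [Module ℝ M] (t : Fin d → ℝ) (v : Fin d → M)
    (i : Fin d) (a : ℝ) :
    ∑ k, Function.update t i a k • v k = ∑ k, t k • v k + (a - t i) • v i := by
  have h : ∀ k, Function.update t i a k = t k + (if k = i then a - t i else 0) := by
    intro k
    by_cases hk : k = i
    · subst hk; simp
    · simp [hk]
  simp [h, add_smul, Finset.sum_add_distrib, ite_smul]

lemma sum_smul_update {M : Type*} [AddCommGroup M] [Module ℝ M] (t : Fin d → ℝ) (v : Fin d → M)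
    (i : Fin d) (w : M) :
    ∑ k, t k • Function.update v i w k = ∑ k, t k • v k + t i • (w - v i) := by
  have h : ∀ k, Function.update v i w k = v k + (if k = i then w - v i else 0) := by
    intro k
    by_cases hk : k = i
    · subst hk; simp
    · simp [hk]
  simp [h, smul_add, Finset.sum_add_distrib, smul_ite]

lemma sum_update (t : Fin d → ℝ) (i : Fin d) (a : ℝ) :
    ∑ k, Function.update t i a k = ∑ k, t k + (a - t i) := by
  simpa using sum_update_smul t (fun _ => (1 : ℝ)) i a

/-- The point dividing the edge from `v i` to `v j` in the ratio `τ : 1 - τ`. -/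
def edgePoint {M : Type*} [AddCommGroup M] [Module ℝ M] (v : Fin d → M) (i j : Fin d) (τ : ℝ) :
    M :=
  (1 - τ) • v i + τ • v j

lemma edgePoint_symm {M : Type*} [AddCommGroup M] [Module ℝ M] (v : Fin d → M) (i j : Fin d)
    (τ : ℝ) : edgePoint v i j τ = edgePoint v j i (1 - τ) := by
  simp [edgePoint, add_comm]

lemma inner_edgePoint (v : Fin d → Euc n) (i j : Fin d) (τ : ℝ) (x : Euc n) :
    ⟪x, edgePoint v i j τ⟫ = edgePoint (fun k => ⟪x, v k⟫) i j τ := by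
  simp [edgePoint, inner_add_right, inner_smul_right]

lemma LinearIndependent.update_edgePoint {v : Fin d → Euc n} (hv : LinearIndependent ℝ v)
    {i j : Fin d} (hij : i ≠ j) {τ : ℝ} (hτ : τ ≠ 0) :
    LinearIndependent ℝ (Function.update v j (edgePoint v i j τ)) := by
  rw [Fintype.linearIndependent_iff]
  intro t ht
  rw [sum_smul_update, edgePoint] at ht
  have h2 : ∑ k, Function.update (Function.update t i (t i + (1 - τ) * t j)) j (τ * t j) k • v k
      = 0 := by
    rw [sum_update_smul, sum_update_smul, ← ht, Function.update_of_ne hij.symm]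
    module
  have h3 := Fintype.linearIndependent_iff.1 hv _ h2
  have hj : t j = 0 := by simpa [hτ] using h3 j
  intro k
  have := h3 k
  by_cases hkj : k = j
  · rw [hkj, hj]
  · by_cases hki : k = i
    · subst hki; simpa [hkj, hj] using this
    · simpa [hkj, hki] using this

variable {v : Fin d → Euc n} {g : Euc n →ₗ[ℝ] (Fin d → ℝ)}

lemma mem_simplexOf_iff_coordinates (hg : ∀ t : Fin d → ℝ, g (∑ i, t i • v i) = t) {y : Euc n} :
    y ∈ simplexOf v ↔ (∀ i, 0 ≤ g y i) ∧ ∑ i, g y i ≤ 1 ∧ y = ∑ i, g y i • v i := by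
  rw [mem_simplexOf]
  constructor
  · rintro ⟨t, h0, h1, rfl⟩
    rw [hg]
    exact ⟨h0, h1, rfl⟩
  · rintro ⟨h0, h1, h2⟩
    exact ⟨_, h0, h1, h2⟩

lemma mem_simplexOf_update_iff (hg : ∀ t : Fin d → ℝ, g (∑ i, t i • v i) = t) {i j : Fin d}
    (hij : i ≠ j) {τ : ℝ} (hτ : 0 < τ) (hτ1 : τ ≤ 1) {y : Euc n} :
    y ∈ simplexOf (Function.update v j (edgePoint v i j τ)) ↔
      y ∈ simplexOf v ∧ (1 - τ) * g y j ≤ τ * g y i := by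
  rw [mem_simplexOf_iff_coordinates hg, mem_simplexOf]
  constructor
  · rintro ⟨t, h0, h1, rfl⟩
    have h2 : ∑ k, t k • Function.update v j (edgePoint v i j τ) k =
        ∑ k, Function.update (Function.update t i (t i + (1 - τ) * t j)) j (τ * t j) k • v k := by
      rw [sum_smul_update, sum_update_smul, sum_update_smul, Function.update_of_ne hij.symm,
        edgePoint]
      module
    rw [h2, hg]
    have := h0 i
    have := h0 j
    have : 0 ≤ 1 - τ := by linarith
    refine ⟨⟨fun k => ?_, ?_, rfl⟩, ?_⟩
    · by_cases hkj : k = j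
      · subst hkj; simp; positivity
      · by_cases hki : k = i
        · subst hki; simp [hkj]; positivity
        · simp [hkj, hki, h0 k]
    · rw [sum_update, sum_update, Function.update_of_ne hij.symm]
      linarith
    · simp [hij]
      nlinarith [mul_nonneg hτ.le (h0 i)]
  · rintro ⟨⟨h0, h1, h2⟩, h3⟩
    refine ⟨Function.update (Function.update (g y) i (g y i - (1 - τ) / τ * g y j)) j (g y j / τ),
      fun k => ?_, ?_, ?_⟩
    · by_cases hkj : k = j
      · subst hkj; simp; exact div_nonneg (h0 k) hτ.le
      · by_cases hki : k = i
        · subst hki; simp [hkj]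
          rw [div_mul_eq_mul_div, div_le_iff₀ hτ]; linarith
        · simp [hkj, hki, h0 k]
    · rw [sum_update, sum_update, Function.update_of_ne hij.symm]
      have : (1 - τ) / τ * g y j = g y j / τ - g y j := by field_simp
      linarith
    · rw [sum_smul_update, sum_update_smul, sum_update_smul, Function.update_of_ne hij.symm,
        ← h2, edgePoint]
      have e2 : (1 - τ) / τ * g y j = (1 - τ) * (g y j / τ) := by ring
      have e1 : g y j = τ * (g y j / τ) := by field_simp
      rw [Function.update_self, e2]
      generalize g y j / τ = c at e1
      rw [e1]
      module

lemma mem_simplexOf_update_iff' (hg : ∀ t : Fin d → ℝ, g (∑ i, t i • v i) = t) {i j : Fin d}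
    (hij : i ≠ j) {τ : ℝ} (hτ : 0 ≤ τ) (hτ1 : τ < 1) {y : Euc n} :
    y ∈ simplexOf (Function.update v i (edgePoint v i j τ)) ↔
      y ∈ simplexOf v ∧ τ * g y i ≤ (1 - τ) * g y j := by
  rw [edgePoint_symm, mem_simplexOf_update_iff hg hij.symm (by linarith) (by linarith)]
  simp

lemma mem_simplexOf_update_update_iff (hg : ∀ t : Fin d → ℝ, g (∑ i, t i • v i) = t)
    {i j : Fin d} (hij : i ≠ j) {σ τ : ℝ} (hσ : 0 < σ) (hστ : σ ≤ τ) (hτ : τ < 1) {y : Euc n} :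
    y ∈ simplexOf (Function.update (Function.update v i (edgePoint v i j σ)) j
        (edgePoint v i j τ)) ↔
      y ∈ simplexOf v ∧ (1 - τ) * g y j ≤ τ * g y i ∧ σ * g y i ≤ (1 - σ) * g y j := by
  rw [mem_simplexOf_iff_coordinates hg, mem_simplexOf]
  have hs : ∀ t : Fin d → ℝ, ∑ k, t k • Function.update (Function.update v i (edgePoint v i j σ)) j
        (edgePoint v i j τ) k =
        ∑ k, Function.update (Function.update t i ((1 - σ) * t i + (1 - τ) * t j)) j
          (σ * t i + τ * t j) k • v k := by
    intro t
    rw [sum_smul_update, sum_smul_update, sum_update_smul, sum_update_smul,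
      Function.update_of_ne hij.symm, Function.update_of_ne hij.symm, edgePoint, edgePoint]
    module
  constructor
  · rintro ⟨t, h0, h1, rfl⟩
    rw [hs, hg]
    have hi := h0 i
    have hj := h0 j
    have : 0 ≤ 1 - τ := by linarith
    have : 0 ≤ 1 - σ := by linarith
    have : 0 ≤ τ := by linarith
    refine ⟨⟨fun k => ?_, ?_, rfl⟩, ?_, ?_⟩
    · by_cases hkj : k = j
      · subst hkj; simp; positivity
      · by_cases hki : k = i
        · subst hki; simp [hkj]; positivity
        · simp [hkj, hki, h0 k]
    · rw [sum_update, sum_update, Function.update_of_ne hij.symm]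
      linarith
    · simp [hij]
      nlinarith
    · simp [hij]
      nlinarith
  · rintro ⟨⟨h0, h1, h2⟩, h3, h4⟩
    obtain ⟨p, q, hp, hq, hpi, hpj⟩ : ∃ p q : ℝ, 0 ≤ p ∧ 0 ≤ q ∧
        (1 - σ) * p + (1 - τ) * q = g y i ∧ σ * p + τ * q = g y j := by
      rcases hστ.eq_or_lt with rfl | hlt
      · refine ⟨g y i + g y j, 0, add_nonneg (h0 i) (h0 j), le_rfl, ?_, ?_⟩ <;> linarith
      · have hne : τ - σ ≠ 0 := by linarith
        refine ⟨(τ * g y i - (1 - τ) * g y j) / (τ - σ), ((1 - σ) * g y j - σ * g y i) / (τ - σ),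
          div_nonneg (by linarith) (by linarith), div_nonneg (by linarith) (by linarith), ?_, ?_⟩
        · field_simp; ring
        · field_simp; ring
    refine ⟨Function.update (Function.update (g y) i p) j q, fun k => ?_, ?_, ?_⟩
    · by_cases hkj : k = j
      · subst hkj; simpa using hq
      · by_cases hki : k = i
        · subst hki; simpa [hkj] using hp
        · simp [hkj, hki, h0 k]
    · rw [sum_update, sum_update, Function.update_of_ne hij.symm]
      linarith
    · rw [hs]
      conv_lhs => rw [h2]
      congr 1
      ext k : 1
      congr 1
      by_cases hkj : k = j
      · subst hkj; simp [hij, hpj]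
      · by_cases hki : k = i
        · subst hki; simp [hij, hpi]
        · simp [hkj, hki]

lemma simplexOf_update_union (hv : LinearIndependent ℝ v) {i j : Fin d} (hij : i ≠ j) {τ : ℝ}
    (hτ : 0 < τ) (hτ1 : τ < 1) :
    simplexOf (Function.update v j (edgePoint v i j τ)) ∪
      simplexOf (Function.update v i (edgePoint v i j τ)) = simplexOf v := by
  obtain ⟨g, hg⟩ := exists_coordinates hv
  ext y
  rw [Set.mem_union, mem_simplexOf_update_iff hg hij hτ hτ1.le,
    mem_simplexOf_update_iff' hg hij hτ.le hτ1]
  constructor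
  · rintro (h | h) <;> exact h.1
  · intro h
    rcases le_total ((1 - τ) * g y j) (τ * g y i) with h' | h'
    · exact Or.inl ⟨h, h'⟩
    · exact Or.inr ⟨h, h'⟩

lemma simplexOf_update_inter (hv : LinearIndependent ℝ v) {i j : Fin d} (hij : i ≠ j) {σ τ : ℝ}
    (hσ : 0 < σ) (hστ : σ ≤ τ) (hτ : τ < 1) :
    simplexOf (Function.update v j (edgePoint v i j τ)) ∩
      simplexOf (Function.update v i (edgePoint v i j σ)) =
    simplexOf (Function.update (Function.update v i (edgePoint v i j σ)) j
        (edgePoint v i j τ)) := by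
  obtain ⟨g, hg⟩ := exists_coordinates hv
  ext y
  rw [Set.mem_inter_iff, mem_simplexOf_update_iff hg hij (by linarith) hτ.le,
    mem_simplexOf_update_iff' hg hij hσ.le (by linarith),
    mem_simplexOf_update_update_iff hg hij hσ hστ hτ]
  tauto

end Cut

section CutFace

variable {n d : ℕ}

lemma range_update_update_self {M : Type*} (v : Fin (d + 1) → M) {i j : Fin (d + 1)} (hij : i ≠ j)
    (w : M) :
    Set.range (Function.update (Function.update v i w) j w) =
      Set.range ((Function.update v i w) ∘ j.succAbove) := by
  obtain ⟨k, hk⟩ := Fin.exists_succAbove_eq hij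
  apply Set.Subset.antisymm
  · rintro _ ⟨l, rfl⟩
    by_cases hl : l = j
    · subst hl
      exact ⟨k, by simp [hk]⟩
    · obtain ⟨m, rfl⟩ := Fin.exists_succAbove_eq hl
      exact ⟨m, by simp⟩
  · rintro _ ⟨m, rfl⟩
    exact ⟨j.succAbove m, by simp⟩

lemma simplexOf_update_inter_self {v : Fin (d + 1) → Euc n} (hv : LinearIndependent ℝ v)
    {i j : Fin (d + 1)} (hij : i ≠ j) {τ : ℝ} (hτ : 0 < τ) (hτ1 : τ < 1) :
    simplexOf (Function.update v j (edgePoint v i j τ)) ∩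
      simplexOf (Function.update v i (edgePoint v i j τ)) =
    simplexOf ((Function.update v i (edgePoint v i j τ)) ∘ j.succAbove) := by
  rw [simplexOf_update_inter hv hij hτ le_rfl hτ1]
  exact simplexOf_congr (range_update_update_self v hij _)

lemma LinearIndependent.update_edgePoint' {v : Fin d → Euc n} (hv : LinearIndependent ℝ v)
    {i j : Fin d} (hij : i ≠ j) {τ : ℝ} (hτ : τ ≠ 1) :
    LinearIndependent ℝ (Function.update v i (edgePoint v i j τ)) := by
  rw [edgePoint_symm]
  exact hv.update_edgePoint hij.symm (sub_ne_zero.2 hτ.symm)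

end CutFace

/-! ### Classification of pairs of simplices whose union is a simplex -/

section Classification

variable {n d p q : ℕ} {v : Fin d → Euc n} {g : Euc n →ₗ[ℝ] (Fin d → ℝ)}

lemma coordinates_edgePoint (hg : ∀ t : Fin d → ℝ, g (∑ i, t i • v i) = t) (i j : Fin d) (τ : ℝ) :
    g (edgePoint v i j τ) = (1 - τ) • Pi.single i 1 + τ • Pi.single j 1 := by
  simp [edgePoint, coordinates_apply_self hg]

lemma sum_coordinates_edgePoint (hg : ∀ t : Fin d → ℝ, g (∑ i, t i • v i) = t) (i j : Fin d)
    (τ : ℝ) : ∑ k, g (edgePoint v i j τ) k = 1 := by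
  simp [coordinates_edgePoint hg, Finset.sum_add_distrib, ← Finset.mul_sum]

lemma edgePoint_mem_simplexOf (v : Fin d → Euc n) (i j : Fin d) {τ : ℝ} (h0 : 0 ≤ τ)
    (h1 : τ ≤ 1) : edgePoint v i j τ ∈ simplexOf v :=
  convex_simplexOf v (mem_simplexOf_self v i) (mem_simplexOf_self v j) (by linarith) h0 (by ring)

/-- The points of the edge `[v i, v j]` form a face of the simplex. -/
lemma mem_edge_of_mem_openSegment (hg : ∀ t : Fin d → ℝ, g (∑ i, t i • v i) = t) {i j : Fin d}
    (hij : i ≠ j) {τ : ℝ} {y z : Euc n} (hy : y ∈ simplexOf v)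
    (hz : z ∈ simplexOf v) (h : edgePoint v i j τ ∈ openSegment ℝ y z) :
    y = edgePoint v i j (g y j) := by
  obtain ⟨α, β, hα, hβ, hαβ, hw⟩ := h
  rw [mem_simplexOf_iff_coordinates hg] at hy hz
  obtain ⟨hy0, hy1, hy2⟩ := hy
  obtain ⟨hz0, hz1, -⟩ := hz
  have hgw : ∀ k, α * g y k + β * g z k = g (edgePoint v i j τ) k := by
    intro k; rw [← hw]; simp
  have hzero : ∀ k, k ≠ i → k ≠ j → g y k = 0 := by
    intro k hki hkj
    have h1 := hgw k
    rw [coordinates_edgePoint hg] at h1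
    simp [hki, hkj] at h1
    have h2 := mul_nonneg hβ.le (hz0 k)
    have h3 := mul_nonneg hα.le (hy0 k)
    have h4 : α * g y k = 0 := by linarith
    exact (mul_eq_zero.1 h4).resolve_left hα.ne'
  have hsum : ∑ k, g y k = 1 := by
    have h1 : α * ∑ k, g y k + β * ∑ k, g z k = 1 := by
      rw [← sum_coordinates_edgePoint hg i j τ, Finset.mul_sum, Finset.mul_sum,
        ← Finset.sum_add_distrib]
      exact Finset.sum_congr rfl fun k _ => hgw k
    have h2 : β * ∑ k, g z k ≤ β := mul_le_of_le_one_right hβ.le hz1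
    by_contra hne
    have h3 : ∑ k, g y k < 1 := lt_of_le_of_ne hy1 hne
    nlinarith
  have hgi : g y i + g y j = 1 := by
    rw [← hsum]
    symm
    exact Finset.sum_eq_add i j hij (fun k _ hk => hzero k hk.1 hk.2) (by simp) (by simp)
  conv_lhs => rw [hy2]
  rw [edgePoint, Finset.sum_eq_add i j hij (fun k _ hk => by rw [hzero k hk.1 hk.2, zero_smul])
    (by simp) (by simp)]
  congr 2
  linarith

lemma edgePoint_ne_zero (hg : ∀ t : Fin d → ℝ, g (∑ i, t i • v i) = t) (i j : Fin d) (τ : ℝ) :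
    edgePoint v i j τ ≠ 0 := by
  intro h
  have := sum_coordinates_edgePoint hg i j τ
  rw [h] at this
  simp at this

lemma mem_range_of_mem_extremePoints {a : Fin p → Euc n} {w : Euc n}
    (hw : w ∈ (simplexOf a).extremePoints ℝ) (h0 : w ≠ 0) : w ∈ Set.range a := by
  rw [simplexOf_eq] at hw
  exact (extremePoints_convexHull_subset hw).resolve_left h0

/-- A subsimplex that contains one end of an edge but not the other has a vertex on that edge. -/
lemma exists_edgePoint_mem_range (hg : ∀ t : Fin d → ℝ, g (∑ i, t i • v i) = t)
    {a : Fin p → Euc n} (hsub : simplexOf a ⊆ simplexOf v) {i j : Fin d} (hij : i ≠ j)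
    (hi : v i ∈ simplexOf a) (hj : v j ∉ simplexOf a) :
    ∃ τ, 0 ≤ τ ∧ τ < 1 ∧ edgePoint v i j τ ∈ Set.range a ∧
      ∀ τ', 0 ≤ τ' → τ' ≤ 1 → edgePoint v i j τ' ∈ simplexOf a → τ' ≤ τ := by
  set S : Set ℝ := Set.Icc 0 1 ∩ (edgePoint v i j) ⁻¹' (simplexOf a) with hS
  have hScomp : IsCompact S := isCompact_Icc.inter_right
    ((isCompact_simplexOf a).isClosed.preimage (by unfold edgePoint; fun_prop))
  have hS0 : S.Nonempty := ⟨0, ⟨by simp, by simpa [edgePoint] using hi⟩⟩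
  obtain ⟨τ, ⟨⟨h0, h1⟩, hτ⟩, hmax⟩ := hScomp.exists_isGreatest hS0
  have hmax' : ∀ τ', 0 ≤ τ' → τ' ≤ 1 → edgePoint v i j τ' ∈ simplexOf a → τ' ≤ τ :=
    fun τ' h0' h1' h => hmax ⟨⟨h0', h1'⟩, h⟩
  have hlt : τ < 1 := by
    refine lt_of_le_of_ne h1 fun h => hj ?_
    rw [h] at hτ
    simpa [edgePoint] using hτ
  refine ⟨τ, h0, hlt, mem_range_of_mem_extremePoints ?_ (edgePoint_ne_zero hg i j τ), hmax'⟩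
  rw [mem_extremePoints]
  have key : ∀ y ∈ simplexOf a, g y j ≤ 1 → 0 ≤ g y j → y = edgePoint v i j (g y j) →
      g y j ≤ τ := fun y hy h1 h0 h => hmax' _ h0 h1 (h ▸ hy)
  refine ⟨hτ, fun y hy z hz h => ?_⟩
  have hy' := mem_edge_of_mem_openSegment hg hij (hsub hy) (hsub hz) h
  have hz' := mem_edge_of_mem_openSegment hg hij (hsub hz) (hsub hy)
    (by rwa [openSegment_symm])
  have hyT := (mem_simplexOf_iff_coordinates hg).1 (hsub hy)
  have hzT := (mem_simplexOf_iff_coordinates hg).1 (hsub hz)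
  have hy1 : g y j ≤ τ := key y hy ((Finset.single_le_sum (fun k _ => hyT.1 k)
    (Finset.mem_univ j)).trans hyT.2.1) (hyT.1 j) hy'
  have hz1 : g z j ≤ τ := key z hz ((Finset.single_le_sum (fun k _ => hzT.1 k)
    (Finset.mem_univ j)).trans hzT.2.1) (hzT.1 j) hz'
  obtain ⟨α, β, hα, hβ, hαβ, hw⟩ := h
  have hgw : α * g y j + β * g z j = τ := by
    have := congrArg (fun w => g w j) hw
    simpa [coordinates_edgePoint hg, hij.symm] using this
  have hyτ : g y j = τ := by
    refine le_antisymm hy1 ?_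
    by_contra hcon
    push Not at hcon
    nlinarith
  have hzτ : g z j = τ := by
    refine le_antisymm hz1 ?_
    by_contra hcon
    push Not at hcon
    nlinarith
  exact ⟨by rw [hy', hyτ], by rw [hz', hzτ]⟩

lemma mem_range_of_vertex_mem (hg : ∀ t : Fin d → ℝ, g (∑ i, t i • v i) = t)
    {a : Fin p → Euc n} (hsub : simplexOf a ⊆ simplexOf v) {i : Fin d}
    (hi : v i ∈ simplexOf a) : v i ∈ Set.range a := by
  have hgi := coordinates_apply_self hg i
  refine mem_range_of_mem_extremePoints ?_ fun h => by
    rw [h, map_zero] at hgi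
    simpa using congrFun hgi i
  have key : ∀ y ∈ simplexOf v, ∀ z ∈ simplexOf v, v i ∈ openSegment ℝ y z → y = v i := by
    rintro y hy z hz ⟨α, β, hα, hβ, hαβ, hw⟩
    rw [mem_simplexOf_iff_coordinates hg] at hy hz
    have hgw : ∀ k, α * g y k + β * g z k = (Pi.single i 1 : Fin d → ℝ) k := by
      intro k; rw [← hgi, ← hw]; simp
    have hle : ∀ {y}, ((∀ i, 0 ≤ g y i) ∧ ∑ i, g y i ≤ 1 ∧ y = ∑ i, g y i • v i) → g y i ≤ 1 :=
      fun h => (Finset.single_le_sum (fun k _ => h.1 k) (Finset.mem_univ i)).trans h.2.1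
    have h1 : g y i = 1 := by
      have h2 := hgw i
      simp only [Pi.single_eq_same] at h2
      by_contra hne
      have h3 := lt_of_le_of_ne (hle hy) hne
      nlinarith [hle hz]
    have h0 : ∀ k, k ≠ i → g y k = 0 := by
      intro k hk
      have h2 := hgw k
      rw [Pi.single_eq_of_ne hk] at h2
      have h3 : α * g y k = 0 := by
        linarith [mul_nonneg hβ.le (hz.1 k), mul_nonneg hα.le (hy.1 k)]
      exact (mul_eq_zero.1 h3).resolve_left hα.ne'
    rw [hy.2.2, Finset.sum_eq_single i (fun k _ hk => by rw [h0 k hk, zero_smul]) (by simp), h1,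
      one_smul]
  rw [mem_extremePoints]
  exact ⟨hi, fun y hy z hz h => ⟨key y (hsub hy) z (hsub hz) h,
    key z (hsub hz) y (hsub hy) (by rwa [openSegment_symm])⟩⟩

lemma one_le_add_of_cover {A B : Set (Euc n)} (hcov : simplexOf v ⊆ A ∪ B) {i j : Fin d} {s t : ℝ}
    (hs0 : 0 ≤ s) (ht0 : 0 ≤ t)
    (hA : ∀ τ', 0 ≤ τ' → τ' ≤ 1 → edgePoint v i j τ' ∈ A → τ' ≤ t)
    (hB : ∀ τ', 0 ≤ τ' → τ' ≤ 1 → edgePoint v j i τ' ∈ B → τ' ≤ s) : 1 ≤ t + s := by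
  by_contra hlt
  push Not at hlt
  set r := (t + 1 - s) / 2 with hr
  have h0 : 0 ≤ r := by linarith
  have h1 : r ≤ 1 := by linarith
  rcases hcov (edgePoint_mem_simplexOf v i j h0 h1) with h | h
  · linarith [hA r h0 h1 h]
  · rw [edgePoint_symm] at h
    linarith [hB (1 - r) (by linarith) (by linarith) h]

lemma false_of_two_cut_edges (hg : ∀ t : Fin d → ℝ, g (∑ i, t i • v i) = t)
    {a : Fin p → Euc n} (ha : LinearIndependent ℝ a) {i i' j : Fin d} (hii' : i ≠ i')
    (hij : i ≠ j) (hi'j : i' ≠ j) (hi : v i ∈ Set.range a) (hi' : v i' ∈ Set.range a)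
    {t t' : ℝ} (ht : 0 < t) (ht1 : t < 1) (ht' : 0 < t')
    (hw : edgePoint v i j t ∈ Set.range a) (hw' : edgePoint v i' j t' ∈ Set.range a) : False := by
  obtain ⟨f, hf⟩ := exists_coordinates ha
  obtain ⟨c, hc⟩ := hw
  have hzero : ∀ y ∈ Set.range a, y ≠ edgePoint v i j t → f y c = 0 := by
    rintro _ ⟨e, rfl⟩ hne
    rw [coordinates_apply_self hf, Pi.single_eq_of_ne]
    rintro rfl
    exact hne hc
  have hone : f (edgePoint v i j t) c = 1 := by
    rw [← hc, coordinates_apply_self hf, Pi.single_eq_same]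
  have h1 : f (v i) c = 0 := hzero _ hi fun h => by
    have := congrFun (congrArg g h) j
    simp [coordinates_edgePoint hg, coordinates_apply_self hg, hij.symm] at this
    exact ht.ne this
  have h2 : f (v i') c = 0 := hzero _ hi' fun h => by
    have := congrFun (congrArg g h) j
    simp [coordinates_edgePoint hg, coordinates_apply_self hg, hij.symm, hi'j.symm] at this
    exact ht.ne this
  have h3 : f (edgePoint v i' j t') c = 0 := hzero _ hw' fun h => by
    have := congrFun (congrArg g h) i
    simp [coordinates_edgePoint hg, hii', hij] at this
    linarith
  simp [edgePoint, h1, h2] at hone h3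
  rcases h3 with h | h
  · exact ht'.ne' h
  · rw [h] at hone
    simp at hone

lemma simplexOf_eq_update (hg : ∀ t : Fin d → ℝ, g (∑ i, t i • v i) = t)
    (hv : LinearIndependent ℝ v) {a : Fin p → Euc n} (ha : LinearIndependent ℝ a)
    (hsub : simplexOf a ⊆ simplexOf v) {i j : Fin d} (hij : i ≠ j) {τ : ℝ} (hτ : 0 < τ)
    (hk : ∀ k, k ≠ j → v k ∈ simplexOf a) (hw : edgePoint v i j τ ∈ Set.range a) :
    simplexOf a = simplexOf (Function.update v j (edgePoint v i j τ)) := by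
  refine (simplexOf_congr ?_).symm
  have hp : p ≤ d := by
    have h : LinearIndependent ℝ (fun k => g (a k)) := by
      refine LinearIndependent.of_comp (Fintype.linearCombination ℝ v) ?_
      convert ha using 1
      ext k : 1
      rw [Function.comp_apply, Fintype.linearCombination_apply]
      exact ((mem_simplexOf_iff_coordinates hg).1 (hsub (mem_simplexOf_self a k))).2.2.symm
    simpa using h.fintype_card_le_finrank
  refine Set.eq_of_subset_of_ncard_le ?_ ?_ (Set.finite_range a)
  · rintro _ ⟨k, rfl⟩
    by_cases h : k = j
    · subst h; simpa using hw
    · simpa [h] using mem_range_of_vertex_mem hg hsub (hk k h)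
  · rw [← Set.image_univ, ← Set.image_univ, Set.ncard_image_of_injective _ ha.injective,
      Set.ncard_image_of_injective _ (hv.update_edgePoint hij hτ.ne').injective]
    simpa using hp

lemma simplexOf_subset_of_vertices_mem {K : Set (Euc n)} (hK : Convex ℝ K) (h0 : (0 : Euc n) ∈ K)
    (h : ∀ i, v i ∈ K) : simplexOf v ⊆ K := by
  rw [simplexOf_eq]
  exact convexHull_min (Set.insert_subset h0 (Set.range_subset_iff.2 h)) hK

theorem simplexOf_union_classification (hv : LinearIndependent ℝ v) {a : Fin p → Euc n}
    {b : Fin q → Euc n} (ha : LinearIndependent ℝ a) (hb : LinearIndependent ℝ b)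
    (hab : simplexOf a ∪ simplexOf b = simplexOf v) :
    simplexOf b ⊆ simplexOf a ∨ simplexOf a ⊆ simplexOf b ∨
      ∃ i j, i ≠ j ∧ ∃ σ τ : ℝ, 0 < σ ∧ σ ≤ τ ∧ τ < 1 ∧
        simplexOf a = simplexOf (Function.update v j (edgePoint v i j τ)) ∧
        simplexOf b = simplexOf (Function.update v i (edgePoint v i j σ)) := by
  obtain ⟨g, hg⟩ := exists_coordinates hv
  have hsa : simplexOf a ⊆ simplexOf v := hab ▸ Set.subset_union_left
  have hsb : simplexOf b ⊆ simplexOf v := hab ▸ Set.subset_union_right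
  by_cases hA : ∀ k, v k ∈ simplexOf a
  · exact Or.inl (hsb.trans
      (simplexOf_subset_of_vertices_mem (convex_simplexOf a) (zero_mem_simplexOf a) hA))
  by_cases hB : ∀ k, v k ∈ simplexOf b
  · exact Or.inr (Or.inl (hsa.trans
      (simplexOf_subset_of_vertices_mem (convex_simplexOf b) (zero_mem_simplexOf b) hB)))
  push Not at hA hB
  obtain ⟨j, hj⟩ := hA
  obtain ⟨i, hi⟩ := hB
  have hcov : ∀ k, v k ∈ simplexOf a ∨ v k ∈ simplexOf b := fun k => by
    have : v k ∈ simplexOf a ∪ simplexOf b := hab ▸ mem_simplexOf_self v k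
    exact this
  have hedge : ∀ {i j}, v j ∉ simplexOf a → v i ∉ simplexOf b → i ≠ j ∧ ∃ σ τ : ℝ,
      0 < σ ∧ σ ≤ τ ∧ τ < 1 ∧ edgePoint v i j τ ∈ Set.range a ∧
        edgePoint v j i (1 - σ) ∈ Set.range b := by
    intro i j hj hi
    have hia := (hcov i).resolve_right hi
    have hjb := (hcov j).resolve_left hj
    have hij : i ≠ j := by rintro rfl; exact hj hia
    obtain ⟨t, ht0, ht1, htr, htm⟩ := exists_edgePoint_mem_range hg hsa hij hia hj
    obtain ⟨s, hs0, hs1, hsr, hsm⟩ := exists_edgePoint_mem_range hg hsb hij.symm hjb hi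
    have := one_le_add_of_cover hab.ge hs0 ht0 htm hsm
    exact ⟨hij, 1 - s, t, by linarith, by linarith, ht1, htr, by simpa using hsr⟩
  obtain ⟨hij, σ, τ, hσ, hστ, hτ, hta, hsb'⟩ := hedge hj hi
  refine Or.inr (Or.inr ⟨i, j, hij, σ, τ, hσ, hστ, hτ, ?_, ?_⟩)
  · refine simplexOf_eq_update hg hv ha hsa hij (by linarith) (fun k hkj => ?_) hta
    by_contra hk
    obtain ⟨hik, σ', τ', hσ', hστ', hτ', -, hsb''⟩ := hedge hk hi
    exact false_of_two_cut_edges hg hb hkj.symm hij.symm hik.symm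
      (mem_range_of_vertex_mem hg hsb ((hcov j).resolve_left hj))
      (mem_range_of_vertex_mem hg hsb ((hcov k).resolve_left hk))
      (by linarith) (by linarith) (by linarith) hsb' hsb''
  · rw [edgePoint_symm]
    refine simplexOf_eq_update hg hv hb hsb hij.symm (by linarith) (fun k hki => ?_) hsb'
    by_contra hk
    obtain ⟨hkj, σ', τ', hσ', hστ', hτ', hta', -⟩ := hedge hj hk
    exact false_of_two_cut_edges hg ha hki.symm hij hkj
      (mem_range_of_vertex_mem hg hsa ((hcov i).resolve_right hi))
      (mem_range_of_vertex_mem hg hsa ((hcov k).resolve_right hk))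
      (by linarith) (by linarith) (by linarith) hta hta'

end Classification

/-! ### The support function of `Dbody` -/

section BodyFun

/-- The support function of `D T` at `x`, in terms of the values of `x` at the vertices of `T`. -/
def bodyFun (a₁ a₂ b₁ b₂ : ℝ) {d : ℕ} (s : Fin d → ℝ) : ℝ :=
  a₂ * max (⨆ i, s i) 0 - (b₂ - b₁) * max (-⨆ i, s i) 0 + b₂ * max (-⨅ i, s i) 0 -
    (a₂ - a₁) * max (⨅ i, s i) 0

variable {n d : ℕ} {a₁ a₂ b₁ b₂ : ℝ}

lemma bodyFun_congr_range {d' : ℕ} {s : Fin d → ℝ} {t : Fin d' → ℝ}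
    (h : Set.range s = Set.range t) : bodyFun a₁ a₂ b₁ b₂ s = bodyFun a₁ a₂ b₁ b₂ t := by
  simp only [bodyFun, iSup, iInf, h]

lemma bodyFun_comp_perm (s : Fin d → ℝ) (σ : Equiv.Perm (Fin d)) :
    bodyFun a₁ a₂ b₁ b₂ (s ∘ σ) = bodyFun a₁ a₂ b₁ b₂ s :=
  bodyFun_congr_range (σ.surjective.range_comp s)

lemma bodyFun_eq_of_bounds {s : Fin d → ℝ} {i j : Fin d} (hi : ∀ k, s k ≤ s i)
    (hj : ∀ k, s j ≤ s k) : bodyFun a₁ a₂ b₁ b₂ s =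
      a₂ * max (s i) 0 - (b₂ - b₁) * max (-s i) 0 + b₂ * max (-s j) 0 -
        (a₂ - a₁) * max (s j) 0 := by
  have : Nonempty (Fin d) := ⟨i⟩
  have h1 : ⨆ k, s k = s i := le_antisymm (ciSup_le hi) (le_ciSup (Finite.bddAbove_range s) i)
  have h2 : ⨅ k, s k = s j := le_antisymm (ciInf_le (Finite.bddBelow_range s) j) (le_ciInf hj)
  rw [bodyFun, h1, h2]

lemma bodyFun_const [Nonempty (Fin d)] (r : ℝ) : bodyFun a₁ a₂ b₁ b₂ (fun _ : Fin d => r) =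
      a₁ * max r 0 + b₁ * max (-r) 0 := by
  rw [bodyFun_eq_of_bounds (i := Classical.arbitrary _) (j := Classical.arbitrary _)
    (fun _ => le_rfl) (fun _ => le_rfl)]
  ring

lemma ciSup_update_eq {s : Fin d → ℝ} {i j : Fin d} (hij : i ≠ j) {r : ℝ} (h1 : s i ≤ s j)
    (h2 : r ≤ s j) : ⨆ k, Function.update s i r k = ⨆ k, s k := by
  have : Nonempty (Fin d) := ⟨i⟩
  apply le_antisymm
  · refine ciSup_le fun k => ?_
    by_cases hk : k = i
    · subst hk
      simpa using h2.trans (le_ciSup (Finite.bddAbove_range s) j)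
    · simpa [hk] using le_ciSup (Finite.bddAbove_range s) k
  · refine ciSup_le fun k => ?_
    have hb := Finite.bddAbove_range (Function.update s i r)
    by_cases hk : k = i
    · subst hk
      refine h1.trans ?_
      simpa [hij.symm] using le_ciSup hb j
    · simpa [hk] using le_ciSup hb k

lemma ciInf_update_eq {s : Fin d → ℝ} {i j : Fin d} (hij : i ≠ j) {r : ℝ} (h1 : s j ≤ s i)
    (h2 : s j ≤ r) : ⨅ k, Function.update s i r k = ⨅ k, s k := by
  have : Nonempty (Fin d) := ⟨i⟩
  apply le_antisymm
  · refine le_ciInf fun k => ?_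
    have hb := Finite.bddBelow_range (Function.update s i r)
    by_cases hk : k = i
    · subst hk
      refine le_trans ?_ h1
      simpa [hij.symm] using ciInf_le hb j
    · simpa [hk] using ciInf_le hb k
  · refine le_ciInf fun k => ?_
    by_cases hk : k = i
    · subst hk
      simpa using (ciInf_le (Finite.bddBelow_range s) j).trans h2
    · simpa [hk] using ciInf_le (Finite.bddBelow_range s) k

lemma bodyFun_update_update_of_le {s : Fin d → ℝ} {i j : Fin d} (hij : i ≠ j) {u w : ℝ}
    (h1 : s i ≤ u) (h2 : u ≤ w) (h3 : w ≤ s j) :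
    bodyFun a₁ a₂ b₁ b₂ s + bodyFun a₁ a₂ b₁ b₂ (Function.update (Function.update s i u) j w) =
      bodyFun a₁ a₂ b₁ b₂ (Function.update s j w) +
        bodyFun a₁ a₂ b₁ b₂ (Function.update s i u) := by
  have e1 : ⨆ k, Function.update s i u k = ⨆ k, s k := ciSup_update_eq hij (by linarith)
    (by linarith)
  have e2 : ⨅ k, Function.update s j w k = ⨅ k, s k := ciInf_update_eq hij.symm (by linarith)
    (by linarith)
  have e3 : ⨆ k, Function.update (Function.update s i u) j w k = ⨆ k, Function.update s j w k := by
    rw [Function.update_comm hij]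
    apply ciSup_update_eq hij <;> simp [hij] <;> linarith
  have e4 : ⨅ k, Function.update (Function.update s i u) j w k = ⨅ k, Function.update s i u k := by
    apply ciInf_update_eq hij.symm <;> simp [hij.symm] <;> linarith
  simp only [bodyFun, e1, e2, e3, e4]
  ring

lemma bodyFun_update_update (s : Fin d → ℝ) {i j : Fin d} (hij : i ≠ j) {σ τ : ℝ} (hσ : 0 ≤ σ)
    (hστ : σ ≤ τ) (hτ : τ ≤ 1) :
    bodyFun a₁ a₂ b₁ b₂ s + bodyFun a₁ a₂ b₁ b₂
        (Function.update (Function.update s i (edgePoint s i j σ)) j (edgePoint s i j τ)) =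
      bodyFun a₁ a₂ b₁ b₂ (Function.update s j (edgePoint s i j τ)) +
        bodyFun a₁ a₂ b₁ b₂ (Function.update s i (edgePoint s i j σ)) := by
  rcases le_total (s i) (s j) with h | h
  · apply bodyFun_update_update_of_le hij <;> simp only [edgePoint, smul_eq_mul] <;> nlinarith
  · rw [Function.update_comm hij, add_comm (bodyFun _ _ _ _ (Function.update s j _))]
    apply bodyFun_update_update_of_le hij.symm <;> simp only [edgePoint, smul_eq_mul] <;> nlinarith

lemma bodyFun_update_self {s : Fin (d + 1) → ℝ} {i j : Fin (d + 1)} (hij : i ≠ j) {τ : ℝ}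
    (hτ : 0 ≤ τ) (hτ1 : τ ≤ 1) :
    bodyFun a₁ a₂ b₁ b₂ s +
        bodyFun a₁ a₂ b₁ b₂ ((Function.update s i (edgePoint s i j τ)) ∘ j.succAbove) =
      bodyFun a₁ a₂ b₁ b₂ (Function.update s j (edgePoint s i j τ)) +
        bodyFun a₁ a₂ b₁ b₂ (Function.update s i (edgePoint s i j τ)) := by
  rw [← bodyFun_update_update s hij hτ le_rfl hτ1]
  congr 1
  exact bodyFun_congr_range (range_update_update_self s hij _).symm

lemma continuous_bodyFun [Nonempty (Fin d)] :
    Continuous (bodyFun a₁ a₂ b₁ b₂ : (Fin d → ℝ) → ℝ) := by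
  have h1 : Continuous fun s : Fin d → ℝ => ⨆ i, s i := by
    simp_rw [← Finset.sup'_univ_eq_ciSup]
    exact Continuous.finset_sup'_apply _ fun i _ => continuous_apply i
  have h2 : Continuous fun s : Fin d → ℝ => ⨅ i, s i := by
    simp_rw [← Finset.inf'_univ_eq_ciInf]
    exact Continuous.finset_inf'_apply _ fun i _ => continuous_apply i
  unfold bodyFun
  fun_prop

lemma bodyFun_smul {c : ℝ} (hc : 0 ≤ c) (s : Fin d → ℝ) :
    bodyFun a₁ a₂ b₁ b₂ (c • s) = c * bodyFun a₁ a₂ b₁ b₂ s := by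
  have h : ∀ r : ℝ, max (c * r) 0 = c * max r 0 := fun r => by
    rw [mul_max_of_nonneg _ _ hc, mul_zero]
  simp only [bodyFun, Pi.smul_apply, smul_eq_mul, ← Real.mul_iSup_of_nonneg hc,
    ← Real.mul_iInf_of_nonneg hc, ← mul_neg, h]
  ring

lemma supp_convexHull_eq {S : Set (Euc n)} (x : Euc n) {c : ℝ} (hle : ∀ y ∈ S, ⟪x, y⟫ ≤ c)
    (hmem : ∃ y ∈ S, ⟪x, y⟫ = c) : supp (convexHull ℝ S) x = c := by
  have hall : ∀ y ∈ convexHull ℝ S, ⟪x, y⟫ ≤ c := fun y hy =>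
    convexHull_min (t := {y | ⟪x, y⟫ ≤ c}) hle
      (convex_halfSpace_le (innerₛₗ ℝ x).isLinear c) hy
  obtain ⟨y, hy, rfl⟩ := hmem
  exact IsGreatest.csSup_eq ⟨⟨y, subset_convexHull _ _ hy, rfl⟩, by
    rintro _ ⟨z, hz, rfl⟩; exact hall z hz⟩

lemma supp_Dbody (h1 : 0 ≤ a₁) (h3 : 0 ≤ b₁) (h5 : a₁ ≤ a₂) (h6 : b₁ ≤ b₂) (h7 : a₂ - a₁ ≤ b₂)
    (h8 : b₂ - b₁ ≤ a₂) [Nonempty (Fin d)] (v : Fin d → Euc n) (x : Euc n) :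
    supp (Dbody a₁ a₂ b₁ b₂ v) x = bodyFun a₁ a₂ b₁ b₂ fun k => ⟪x, v k⟫ := by
  obtain ⟨i, hi⟩ := Finite.exists_max fun k => ⟪x, v k⟫
  obtain ⟨j, hj⟩ := Finite.exists_min fun k => ⟪x, v k⟫
  rw [bodyFun_eq_of_bounds hi hj]
  have hij := hi j
  have h2 : 0 ≤ a₂ := h1.trans h5
  have h4 : 0 ≤ b₂ := h3.trans h6
  set M := ⟪x, v i⟫
  set m := ⟪x, v j⟫
  apply supp_convexHull_eq
  · rintro _ ⟨k, l, rfl | rfl | rfl⟩ <;>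
    · have hk := hi k
      have hl := hj l
      simp only [inner_sub_right, inner_smul_right]
      set r := ⟪x, v k⟫
      set s := ⟪x, v l⟫
      have e1 := mul_nonneg h2 (sub_nonneg.2 hk)
      have e2 := mul_nonneg h4 (sub_nonneg.2 hl)
      have e3 := mul_nonneg (sub_nonneg.2 h5) (sub_nonneg.2 hl)
      have e4 := mul_nonneg (sub_nonneg.2 h6) (sub_nonneg.2 hk)
      rcases le_total M 0 with hM | hM <;> rcases le_total m 0 with hm | hm <;>
        simp only [max_eq_left, max_eq_right, hM, hm, neg_nonneg, neg_nonpos] <;> nlinarith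
  · rcases le_total M 0 with hM | hM
    · have hm := hij.trans hM
      refine ⟨_, ⟨i, j, Or.inr (Or.inr rfl)⟩, ?_⟩
      simp only [inner_sub_right, inner_smul_right, max_eq_left, max_eq_right, hM, hm, neg_nonneg]
      ring
    · rcases le_total m 0 with hm | hm
      · refine ⟨_, ⟨i, j, Or.inl rfl⟩, ?_⟩
        simp only [inner_sub_right, inner_smul_right, max_eq_left, max_eq_right, hM, hm,
          neg_nonneg, neg_nonpos]
        ring
      · refine ⟨_, ⟨i, j, Or.inr (Or.inl rfl)⟩, ?_⟩
        simp only [inner_sub_right, inner_smul_right, max_eq_left, max_eq_right, hM, hm,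
          neg_nonpos]
        ring

lemma supp_segment (h1 : 0 ≤ a₁) (h3 : 0 ≤ b₁) (v x : Euc n) :
    supp (convexHull ℝ {-b₁ • v, a₁ • v}) x = a₁ * max ⟪x, v⟫ 0 + b₁ * max (-⟪x, v⟫) 0 := by
  set r := ⟪x, v⟫ with hr
  have e1 : ⟪x, -b₁ • v⟫ = -(b₁ * r) := by rw [inner_smul_right]; ring
  have e2 : ⟪x, a₁ • v⟫ = a₁ * r := by rw [inner_smul_right]
  apply supp_convexHull_eq
  · rintro y (rfl | rfl) <;> rcases le_total r 0 with h | h <;>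
      simp only [e1, e2, max_eq_left, max_eq_right, h, neg_nonneg, neg_nonpos] <;> nlinarith
  · rcases le_total r 0 with h | h
    · exact ⟨_, Or.inl rfl, by rw [e1]; simp [h]⟩
    · exact ⟨_, Or.inr rfl, by simp [e2, h]⟩

end BodyFun

/-! ### Asymmetric moment bodies -/

section Moment

variable {n d : ℕ} {K L : Set (Euc n)}

lemma mMinus1_eq (K : Set (Euc n)) (x : Euc n) : mMinus1 K x = mPlus1 K (-x) := by
  simp [mMinus1, mPlus1]

lemma integrableOn_moment (hK : IsCompact K) (x : Euc n) :
    IntegrableOn (fun y : Euc n => max ⟪x, y⟫ 0) K :=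
  (Continuous.continuousOn (by fun_prop)).integrableOn_compact hK

lemma mPlus1_union_add_inter (hK : IsCompact K) (hL : IsCompact L) (x : Euc n) :
    mPlus1 (K ∪ L) x + mPlus1 (K ∩ L) x = mPlus1 K x + mPlus1 L x := by
  have hKi := integrableOn_moment hK x
  have hLi := integrableOn_moment hL x
  have h1 := integral_inter_add_sdiff (μ := volume) hL.measurableSet hKi
  have h2 := setIntegral_union (μ := volume) (f := fun y : Euc n => max ⟪x, y⟫ 0)
    (Set.disjoint_sdiff_left (t := K) (s := L)) hL.measurableSet (hKi.mono_set Set.sdiff_subset)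
    hLi
  rw [Set.sdiff_union_self] at h2
  unfold mPlus1
  linarith

lemma det_toEuclideanLin (A : Matrix (Fin n) (Fin n) ℝ) :
    LinearMap.det (Matrix.toEuclideanLin A) = A.det := by
  rw [Matrix.toEuclideanLin, Matrix.toLpLin_eq_toLin, LinearMap.det_toLin]

lemma toEuclideanLin_injective {A : Matrix (Fin n) (Fin n) ℝ} (hA : A.det ≠ 0) :
    Function.Injective (Matrix.toEuclideanLin A) :=
  (LinearMap.equivOfDetNeZero (Matrix.toEuclideanLin A)
    (by rwa [det_toEuclideanLin])).injective

lemma mPlus1_matAct {A : Matrix (Fin n) (Fin n) ℝ} (hA : A.det ≠ 0) (hK : IsCompact K)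
    (x : Euc n) :
    mPlus1 (matAct A K) x = |A.det| * mPlus1 K (Matrix.toEuclideanLin Aᵀ x) := by
  set f : Euc n →L[ℝ] Euc n := LinearMap.toContinuousLinearMap (Matrix.toEuclideanLin A) with hf
  have hdet : f.det = A.det := by
    rw [hf, LinearMap.det_toContinuousLinearMap, det_toEuclideanLin]
  have hinj : Function.Injective f := toEuclideanLin_injective hA
  have := integral_image_eq_integral_abs_det_fderiv_smul (μ := volume) (f := f)
    (f' := fun _ => f) hK.measurableSet (fun y _ => f.hasFDerivAt.hasFDerivWithinAt)
    hinj.injOn (fun y : Euc n => max ⟪x, y⟫ 0)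
  unfold mPlus1 matAct
  rw [show (Matrix.toEuclideanLin A : Euc n → Euc n) '' K = f '' K from rfl, this, hdet]
  simp only [smul_eq_mul]
  rw [integral_const_mul]
  congr 1
  refine integral_congr_ae (Filter.Eventually.of_forall fun y => ?_)
  show max ⟪x, Matrix.toEuclideanLin A y⟫ 0 = _
  rw [inner_toEuclideanLin]

lemma mPlus1_simplexOf_of_lt (hd : d < n) (v : Fin d → Euc n) (x : Euc n) :
    mPlus1 (simplexOf v) x = 0 := by
  have hne : Submodule.span ℝ (Set.range v) ≠ ⊤ := by
    intro h
    have h1 := finrank_range_le_card (R := ℝ) v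
    rw [Set.finrank, h, finrank_top] at h1
    simp at h1
    omega
  have hsub : simplexOf v ⊆ Submodule.span ℝ (Set.range v) :=
    simplexOf_subset_of_vertices_mem (Submodule.convex _) (Submodule.zero_mem _)
      fun i => Submodule.subset_span ⟨i, rfl⟩
  exact setIntegral_measure_zero _ (measure_mono_null hsub (Measure.addHaar_submodule _ _ hne))

lemma mPlus1_smul (K : Set (Euc n)) {c : ℝ} (hc : 0 ≤ c) (x : Euc n) :
    mPlus1 K (c • x) = c * mPlus1 K x := by
  unfold mPlus1
  rw [← integral_const_mul]
  congr 1
  ext y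
  rw [inner_smul_left, mul_max_of_nonneg _ _ hc, mul_zero]
  rfl

lemma continuous_mPlus1 (hK : IsCompact K) : Continuous (mPlus1 K) :=
  continuous_parametric_integral_of_continuous (by fun_prop) hK

end Moment

/-! ### The bodies in the classification form a covariant valuation -/

section Sufficiency

variable {n : ℕ}

lemma inner_update {d : ℕ} (x : Euc n) (v : Fin d → Euc n) (k : Fin d) (y : Euc n) :
    (fun l => ⟪x, Function.update v k y l⟫) =
      Function.update (fun l => ⟪x, v l⟫) k ⟪x, y⟫ := by
  ext l
  by_cases hl : l = k
  · subst hl; simp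
  · simp [hl]

/-- The support function of `Z T` is the one in the classification, for all simplices `T`. -/
def HasForm (Z : Set (Euc n) → Set (Euc n)) (a₁ a₂ b₁ b₂ c₁ c₂ : ℝ) : Prop :=
  ∀ (d : ℕ) (v : Fin d → Euc n), 1 ≤ d → LinearIndependent ℝ v → ∀ x : Euc n,
    supp (Z (simplexOf v)) x = c₁ * mPlus1 (simplexOf v) x + c₂ * mMinus1 (simplexOf v) x +
      bodyFun a₁ a₂ b₁ b₂ fun i => ⟪x, v i⟫

lemma hasForm_iff {Z : Set (Euc n) → Set (Euc n)} {a₁ a₂ b₁ b₂ c₁ c₂ : ℝ}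
    (h1 : 0 ≤ a₁) (h3 : 0 ≤ b₁) (h5 : a₁ ≤ a₂) (h6 : b₁ ≤ b₂) (h7 : a₂ - a₁ ≤ b₂)
    (h8 : b₂ - b₁ ≤ a₂) :
    HasForm Z a₁ a₂ b₁ b₂ c₁ c₂ ↔
      (∀ (d : ℕ) (v : Fin d → Euc n), 2 ≤ d → d ≤ n →
          AffineIndependent ℝ (Fin.cons (0 : Euc n) v : Fin (d + 1) → Euc n) →
          ∀ x : Euc n, supp (Z (simplexOf v)) x
            = c₁ * mPlus1 (simplexOf v) x + c₂ * mMinus1 (simplexOf v) x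
              + supp (Dbody a₁ a₂ b₁ b₂ v) x) ∧
        (∀ v₁ : Euc n, v₁ ≠ 0 →
          ∀ x : Euc n, supp (Z (convexHull ℝ {0, v₁})) x
            = c₁ * mPlus1 (convexHull ℝ {0, v₁}) x + c₂ * mMinus1 (convexHull ℝ {0, v₁}) x
              + supp (convexHull ℝ {-b₁ • v₁, a₁ • v₁}) x) := by
  have hseg : ∀ v : Fin 1 → Euc n, simplexOf v = convexHull ℝ {0, v 0} := fun v => by
    rw [simplexOf_eq, Set.range_unique]
    rfl
  have hbf : ∀ (v : Fin 1 → Euc n) (x : Euc n), bodyFun a₁ a₂ b₁ b₂ (fun i => ⟪x, v i⟫) =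
      supp (convexHull ℝ {-b₁ • v 0, a₁ • v 0}) x := fun v x => by
    rw [supp_segment h1 h3, ← bodyFun_const (d := 1) (a₂ := a₂) (b₂ := b₂)]
    congr 1
    ext i
    rw [Subsingleton.elim i 0]
  constructor
  · refine fun h => ⟨fun d v hd _ hv x => ?_, fun v hv x => ?_⟩
    · have : Nonempty (Fin d) := ⟨⟨0, by omega⟩⟩
      rw [supp_Dbody h1 h3 h5 h6 h7 h8]
      exact h d v (by omega) ((affineIndependent_cons_zero_iff v).1 hv) x
    · have := h 1 (fun _ => v) le_rfl (LinearIndependent.of_subsingleton 0 hv) x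
      rwa [hseg, hbf] at this
  · rintro ⟨hD, hS⟩ d v hd hv x
    rcases hd.eq_or_lt with rfl | hd
    · rw [hseg, hbf]
      exact hS _ (hv.ne_zero 0) x
    · have : Nonempty (Fin d) := ⟨⟨0, by omega⟩⟩
      rw [← supp_Dbody h1 h3 h5 h6 h7 h8]
      exact hD d v hd hv.le_dim ((affineIndependent_cons_zero_iff v).2 hv) x

variable {Z : Set (Euc n) → Set (Euc n)} {a₁ a₂ b₁ b₂ c₁ c₂ : ℝ}

lemma isCompact_matAct (A : Matrix (Fin n) (Fin n) ℝ) {K : Set (Euc n)} (hK : IsCompact K) :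
    IsCompact (matAct A K) :=
  hK.image (Matrix.toEuclideanLin A).continuous_of_finiteDimensional

lemma linearIndependent_matAct {d : ℕ} {A : Matrix (Fin n) (Fin n) ℝ} (hA : A.det ≠ 0)
    {v : Fin d → Euc n} (hv : LinearIndependent ℝ v) :
    LinearIndependent ℝ fun i => Matrix.toEuclideanLin A (v i) :=
  hv.map' _ (LinearMap.ker_eq_bot_of_injective (toEuclideanLin_injective hA))

lemma HasForm.covariant (h : HasForm Z a₁ a₂ b₁ b₂ c₁ c₂)
    (hbody : ∀ T : Set (Euc n), IsSimplex0 T → IsConvexBody0 (Z T))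
    (φ : Matrix.SpecialLinearGroup (Fin n) ℝ) {T : Set (Euc n)} (hT : IsSimplex0 T) :
    Z (matAct (φ : Matrix (Fin n) (Fin n) ℝ) T)
      = matAct (φ : Matrix (Fin n) (Fin n) ℝ) (Z T) := by
  obtain ⟨d, v, hd, hv, rfl⟩ := isSimplex0_iff.1 hT
  have hφ : (φ : Matrix (Fin n) (Fin n) ℝ).det ≠ 0 := by simp
  have hφv := linearIndependent_matAct hφ hv
  obtain ⟨hc, hcv, h0⟩ := hbody _ hT
  have hb' := hbody _ (hφv.isSimplex0 hd)
  rw [← matAct_simplexOf] at hb'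
  obtain ⟨hc', hcv', h0'⟩ := hb'
  refine eq_of_supp_eq hc' (isCompact_matAct _ hc) hcv' (hcv.linear_image _) ⟨0, h0'⟩
    (Set.Nonempty.image _ ⟨0, h0⟩) fun x => ?_
  rw [supp_matAct, h d v hd hv, mMinus1_eq, matAct_simplexOf, h d _ hd hφv, ← matAct_simplexOf,
    mMinus1_eq, mPlus1_matAct hφ (isCompact_simplexOf v), mPlus1_matAct hφ (isCompact_simplexOf v)]
  simp [inner_toEuclideanLin]

lemma HasForm.valuation (h : HasForm Z a₁ a₂ b₁ b₂ c₁ c₂)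
    (hbody : ∀ T : Set (Euc n), IsSimplex0 T → IsConvexBody0 (Z T))
    {K L : Set (Euc n)} (hK : IsSimplex0 K) (hL : IsSimplex0 L) (hKL : IsSimplex0 (K ∪ L))
    (hKL' : IsSimplex0 (K ∩ L)) : Z (K ∪ L) + Z (K ∩ L) = Z K + Z L := by
  obtain ⟨hc1, hv1, h01⟩ := hbody _ hK
  obtain ⟨hc2, hv2, h02⟩ := hbody _ hL
  obtain ⟨hc3, hv3, h03⟩ := hbody _ hKL
  obtain ⟨hc4, hv4, h04⟩ := hbody _ hKL'
  refine eq_of_supp_eq (hc3.add hc4) (hc1.add hc2) (hv3.add hv4) (hv1.add hv2)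
    ⟨0, 0, h03, 0, h04, add_zero _⟩ ⟨0, 0, h01, 0, h02, add_zero _⟩ fun x => ?_
  rw [supp_add_set hc3 hc4 ⟨0, h03⟩ ⟨0, h04⟩, supp_add_set hc1 hc2 ⟨0, h01⟩ ⟨0, h02⟩]
  obtain ⟨p, a, hp, ha, rfl⟩ := isSimplex0_iff.1 hK
  obtain ⟨q, b, hq, hb, rfl⟩ := isSimplex0_iff.1 hL
  obtain ⟨d, v, hd, hv, hT⟩ := isSimplex0_iff.1 hKL
  rcases simplexOf_union_classification hv ha hb hT with hsub | hsub |
    ⟨i, j, hij, σ, τ, hσ, hστ, hτ, hKe, hLe⟩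
  · rw [Set.union_eq_left.2 hsub, Set.inter_eq_right.2 hsub]
  · rw [Set.union_eq_right.2 hsub, Set.inter_eq_left.2 hsub, add_comm]
  have hA := hv.update_edgePoint hij (τ := τ) (by linarith)
  have hB := hv.update_edgePoint' hij (τ := σ) (by linarith)
  have hm : ∀ x, mPlus1 (simplexOf v) x + mPlus1 (simplexOf a ∩ simplexOf b) x =
      mPlus1 (simplexOf a) x + mPlus1 (simplexOf b) x := fun x => by
    rw [← hT]
    exact mPlus1_union_add_inter (isCompact_simplexOf a) (isCompact_simplexOf b) x
  have hI : supp (Z (simplexOf a ∩ simplexOf b)) x =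
      c₁ * mPlus1 (simplexOf a ∩ simplexOf b) x + c₂ * mMinus1 (simplexOf a ∩ simplexOf b) x +
      bodyFun a₁ a₂ b₁ b₂ (Function.update (Function.update (fun k => ⟪x, v k⟫) i
        (edgePoint (fun k => ⟪x, v k⟫) i j σ)) j (edgePoint (fun k => ⟪x, v k⟫) i j τ)) := by
    rw [hKe, hLe, simplexOf_update_inter hv hij hσ hστ hτ]
    rcases hστ.eq_or_lt with rfl | hlt
    · obtain ⟨d, rfl⟩ : ∃ e, d = e + 1 := ⟨d - 1, by omega⟩
      obtain ⟨k, -⟩ := Fin.exists_succAbove_eq hij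
      rw [simplexOf_congr (range_update_update_self v hij _),
        h d _ (by have := k.2; omega) (hB.comp _ Fin.succAbove_right_injective)]
      congr 1
      rw [bodyFun_congr_range (range_update_update_self _ hij _), ← inner_edgePoint, ← inner_update]
      rfl
    · rw [h d _ hd]
      · rw [inner_update, inner_update, inner_edgePoint, inner_edgePoint]
      · have hee : edgePoint v i j τ =
            edgePoint (Function.update v i (edgePoint v i j σ)) i j ((τ - σ) / (1 - σ)) := by
          have : (1 : ℝ) - σ ≠ 0 := by linarith
          have h1 : 1 - (τ - σ) / (1 - σ) = (1 - τ) / (1 - σ) := by field_simp; ring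
          simp only [edgePoint, Function.update_self, Function.update_of_ne hij.symm, h1, smul_add,
            smul_smul]
          rw [add_assoc, ← add_smul]
          congr 2
          · field_simp
          · field_simp; ring
        rw [hee]
        exact hB.update_edgePoint hij (div_ne_zero (by linarith) (by linarith))
  rw [hT, hI, h d v hd hv]
  have hKs : supp (Z (simplexOf a)) x = c₁ * mPlus1 (simplexOf a) x +
      c₂ * mMinus1 (simplexOf a) x + bodyFun a₁ a₂ b₁ b₂
        (Function.update (fun k => ⟪x, v k⟫) j (edgePoint (fun k => ⟪x, v k⟫) i j τ)) := by
    rw [hKe, h d _ hd hA, inner_update, inner_edgePoint]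
  have hLs : supp (Z (simplexOf b)) x = c₁ * mPlus1 (simplexOf b) x +
      c₂ * mMinus1 (simplexOf b) x + bodyFun a₁ a₂ b₁ b₂
        (Function.update (fun k => ⟪x, v k⟫) i (edgePoint (fun k => ⟪x, v k⟫) i j σ)) := by
    rw [hLe, h d _ hd hB, inner_update, inner_edgePoint]
  rw [hKs, hLs]
  simp only [mMinus1_eq]
  have hbody := bodyFun_update_update (a₁ := a₁) (a₂ := a₂) (b₁ := b₁) (b₂ := b₂)
    (fun k => ⟪x, v k⟫) hij hσ.le hστ hτ.le
  linear_combination c₁ * hm x + c₂ * hm (-x) + hbody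

end Sufficiency

/-! ### Matrices with prescribed columns -/

section Columns

variable {n d : ℕ}

/-- The matrix with columns `v 0, …, v (n - 1)`. -/
def colMatrix (v : Fin n → Euc n) : Matrix (Fin n) (Fin n) ℝ :=
  Matrix.of fun a i => v i a

lemma toEuclideanLin_mul (A B : Matrix (Fin n) (Fin n) ℝ) (x : Euc n) :
    Matrix.toEuclideanLin (A * B) x = Matrix.toEuclideanLin A (Matrix.toEuclideanLin B x) := by
  simp [Matrix.toLpLin_apply]

lemma toEuclideanLin_colMatrix (v : Fin n → Euc n) (i : Fin n) :
    Matrix.toEuclideanLin (colMatrix v) (EuclideanSpace.single i 1) = v i := by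
  ext a
  simp [Matrix.toLpLin_apply, colMatrix]

lemma det_colMatrix_ne_zero {v : Fin n → Euc n} (hv : LinearIndependent ℝ v) :
    (colMatrix v).det ≠ 0 := by
  have h : LinearIndependent ℝ (colMatrix v).col :=
    hv.map' (WithLp.linearEquiv 2 ℝ (Fin n → ℝ)).toLinearMap (LinearEquiv.ker _)
  exact ((Matrix.isUnit_iff_isUnit_det _).1 (Matrix.linearIndependent_cols_iff_isUnit.1 h)).ne_zero

/-- The matrix taking the basis `v` to `w`. -/
lemma exists_matrix_map {v : Fin n → Euc n} (hv : LinearIndependent ℝ v) (w : Fin n → Euc n) :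
    ∃ A : Matrix (Fin n) (Fin n) ℝ, (∀ i, Matrix.toEuclideanLin A (v i) = w i) ∧
      A.det * (colMatrix v).det = (colMatrix w).det := by
  have hu : IsUnit (colMatrix v).det := (det_colMatrix_ne_zero hv).isUnit
  have h : colMatrix w * (colMatrix v)⁻¹ * colMatrix v = colMatrix w := by
    rw [Matrix.mul_assoc, Matrix.nonsing_inv_mul _ hu, Matrix.mul_one]
  refine ⟨colMatrix w * (colMatrix v)⁻¹, fun i => ?_, ?_⟩
  · rw [← toEuclideanLin_colMatrix v i, ← toEuclideanLin_mul, h, toEuclideanLin_colMatrix]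
  · rw [← Matrix.det_mul, h]

lemma colMatrix_update (v : Fin n → Euc n) (j : Fin n) (w : Euc n) :
    colMatrix (Function.update v j w) = (colMatrix v).updateCol j w := by
  ext a i
  by_cases h : i = j
  · subst h; simp [colMatrix]
  · simp [colMatrix, h]

lemma det_colMatrix_update_smul (v : Fin n → Euc n) (j : Fin n) (c : ℝ) :
    (colMatrix (Function.update v j (c • v j))).det = c * (colMatrix v).det := by
  rw [colMatrix_update]
  have := Matrix.det_updateCol_smul (colMatrix v) j c (v j)
  rw [show ((c • v j : Euc n) : Fin n → ℝ) = c • (v j : Fin n → ℝ) from rfl, this,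
    ← colMatrix_update, Function.update_eq_self]

lemma det_colMatrix_update_edgePoint (v : Fin n → Euc n) {i j : Fin n} (hij : i ≠ j) (τ : ℝ) :
    (colMatrix (Function.update v j (edgePoint v i j τ))).det = τ * (colMatrix v).det := by
  rw [colMatrix_update]
  have h0 : ((colMatrix v).updateCol j (v i)).det = 0 :=
    Matrix.det_zero_of_column_eq hij fun k => by simp [colMatrix, hij]
  rw [show ((edgePoint v i j τ : Euc n) : Fin n → ℝ) =
    (1 - τ) • (v i : Fin n → ℝ) + τ • (v j : Fin n → ℝ) from rfl, Matrix.det_updateCol_add,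
    Matrix.det_updateCol_smul, Matrix.det_updateCol_smul, h0, ← colMatrix_update,
    Function.update_eq_self, mul_zero, zero_add]

lemma det_colMatrix_update_edgePoint' (v : Fin n → Euc n) {i j : Fin n} (hij : i ≠ j) (τ : ℝ) :
    (colMatrix (Function.update v i (edgePoint v i j τ))).det =
      (1 - τ) * (colMatrix v).det := by
  rw [edgePoint_symm, det_colMatrix_update_edgePoint v hij.symm]

lemma det_colMatrix_swap (v : Fin n → Euc n) {i j : Fin n} (hij : i ≠ j) :
    (colMatrix (v ∘ Equiv.swap i j)).det = -(colMatrix v).det := by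
  have := Matrix.det_permute' (Equiv.swap i j) (colMatrix v)
  rw [Equiv.Perm.sign_swap hij] at this
  simp only [Units.val_neg, Units.val_one, Int.cast_neg, Int.cast_one, neg_mul, one_mul] at this
  exact this

lemma LinearIndependent.exists_extension {v : Fin d → Euc n} (hv : LinearIndependent ℝ v) :
    ∃ w : Fin n → Euc n, LinearIndependent ℝ w ∧ ∀ i, w (Fin.castLE hv.le_dim i) = v i := by
  obtain ⟨k, hk⟩ := Nat.exists_eq_add_of_le hv.le_dim
  induction k generalizing d with
  | zero =>
    obtain rfl : n = d := hk
    exact ⟨v, hv, fun i => rfl⟩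
  | succ k ih =>
    obtain ⟨x, hx⟩ := exists_linearIndependent_snoc_of_lt_finrank hv (by simp; omega)
    obtain ⟨w, hw, h⟩ := ih hx (by omega)
    refine ⟨w, hw, fun i => ?_⟩
    simpa using h i.castSucc

/-- `SL(n)` acts transitively on linearly independent families of fewer than `n` vectors. -/
lemma exists_specialLinearGroup_map (hd : d < n) {v w : Fin d → Euc n}
    (hv : LinearIndependent ℝ v) (hw : LinearIndependent ℝ w) :
    ∃ φ : Matrix.SpecialLinearGroup (Fin n) ℝ,
      ∀ i, Matrix.toEuclideanLin (φ : Matrix (Fin n) (Fin n) ℝ) (v i) = w i := by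
  obtain ⟨v', hv', hvv'⟩ := hv.exists_extension
  obtain ⟨w', hw', hww'⟩ := hw.exists_extension
  have hw0 := det_colMatrix_ne_zero hw'
  have hv0 := det_colMatrix_ne_zero hv'
  let j : Fin n := ⟨d, hd⟩
  obtain ⟨A, hA, hdet⟩ := exists_matrix_map hv' (Function.update w' j
    (((colMatrix v').det / (colMatrix w').det) • w' j))
  rw [det_colMatrix_update_smul, div_mul_cancel₀ _ hw0] at hdet
  refine ⟨⟨A, mul_right_cancel₀ hv0 (by rw [hdet, one_mul])⟩, fun i => ?_⟩
  have hne : Fin.castLE hd.le i ≠ j := fun h => by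
    have := congrArg Fin.val h
    simp [j] at this
    omega
  rw [← hvv', ← hww', hA, Function.update_of_ne hne]

lemma LinearIndependent.exists_dual {v : Fin d → Euc n} (hv : LinearIndependent ℝ v) :
    ∃ L : (Fin d → ℝ) →ₗ[ℝ] Euc n, ∀ s i, ⟪L s, v i⟫ = s i := by
  obtain ⟨g, hg⟩ := exists_coordinates hv
  have hgc (k : Fin d) : ∃ y : Euc n, ∀ z, ⟪y, z⟫ = g z k := by
    refine ⟨(InnerProductSpace.toDual ℝ (Euc n)).symm
      (LinearMap.toContinuousLinearMap (LinearMap.proj k ∘ₗ g)), fun z => ?_⟩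
    rw [InnerProductSpace.toDual_symm_apply]
    rfl
  choose y hy using hgc
  refine ⟨Fintype.linearCombination ℝ y, fun s i => ?_⟩
  simp [Fintype.linearCombination_apply, sum_inner, inner_smul_left, hy,
    coordinates_apply_self hg, Pi.single_apply]

lemma LinearIndependent.ext_inner {v : Fin n → Euc n} (hv : LinearIndependent ℝ v) {x y : Euc n}
    (h : ∀ i, ⟪x, v i⟫ = ⟪y, v i⟫) : x = y := by
  have hspan : Submodule.span ℝ (Set.range v) = ⊤ :=
    hv.span_eq_top_of_card_eq_finrank' (by simp)
  refine ext_inner_right ℝ fun z => ?_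
  have hz : z ∈ Submodule.span ℝ (Set.range v) := hspan ▸ Submodule.mem_top
  induction hz using Submodule.span_induction with
  | mem z hz =>
    obtain ⟨i, rfl⟩ := hz
    exact h i
  | zero => simp
  | add a b _ _ ha hb => rw [inner_add_right, inner_add_right, ha, hb]
  | smul c a _ ha => rw [inner_smul_right, inner_smul_right, ha]

end Columns

/-! ### Reduction to functions of the inner products with the vertices -/

section Reduction

variable {n d : ℕ} {Z : Set (Euc n) → Set (Euc n)}

/-- An `SL(n)` covariant Minkowski valuation from simplices to convex bodies. -/
structure IsCovariantValuation (Z : Set (Euc n) → Set (Euc n)) : Prop where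
  isConvexBody0 : ∀ T : Set (Euc n), IsSimplex0 T → IsConvexBody0 (Z T)
  add_inter : ∀ K L : Set (Euc n), IsSimplex0 K → IsSimplex0 L → IsSimplex0 (K ∪ L) →
    IsSimplex0 (K ∩ L) → Z (K ∪ L) + Z (K ∩ L) = Z K + Z L
  covariant : ∀ (φ : Matrix.SpecialLinearGroup (Fin n) ℝ) (T : Set (Euc n)), IsSimplex0 T →
    Z (matAct (φ : Matrix (Fin n) (Fin n) ℝ) T) = matAct (φ : Matrix (Fin n) (Fin n) ℝ) (Z T)

namespace IsCovariantValuation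

lemma image_simplexOf (hZ : IsCovariantValuation Z) (hd : 1 ≤ d) {v w : Fin d → Euc n}
    (hv : LinearIndependent ℝ v) {φ : Matrix.SpecialLinearGroup (Fin n) ℝ}
    (hφ : ∀ i, Matrix.toEuclideanLin (φ : Matrix (Fin n) (Fin n) ℝ) (v i) = w i) :
    matAct (φ : Matrix (Fin n) (Fin n) ℝ) (Z (simplexOf v)) = Z (simplexOf w) := by
  rw [← hZ.covariant φ _ (hv.isSimplex0 hd), matAct_simplexOf, funext hφ]

/-- `Z T` lies in the linear hull of `T` if `T` is not full-dimensional. -/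
lemma inner_eq_zero (hZ : IsCovariantValuation Z) (hd : 1 ≤ d) {v : Fin d → Euc n}
    (hv : LinearIndependent ℝ v) {u z : Euc n} (hu : ∀ i, ⟪u, v i⟫ = 0)
    (hz : z ∈ Z (simplexOf v)) : ⟪u, z⟫ = 0 := by
  have hn : n ≠ 0 := by have := hv.le_dim; omega
  let i₀ : Fin d := ⟨0, hd⟩
  have hact (t : ℝ) (y : Euc n) : Matrix.toEuclideanLin
      (1 + Matrix.vecMulVec (fun a => t * v i₀ a) (fun a => u a)) y = y + (t * ⟪u, y⟫) • v i₀ := by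
    ext a
    simp [Matrix.toLpLin_apply, Matrix.vecMulVec_mulVec, PiLp.inner_apply, dotProduct, mul_comm]
    ring
  have hmem (t : ℝ) : z + (t * ⟪u, z⟫) • v i₀ ∈ Z (simplexOf v) := by
    let φ : Matrix.SpecialLinearGroup (Fin n) ℝ :=
      ⟨1 + Matrix.vecMulVec (fun a => t * v i₀ a) (fun a => u a), by
        rw [Matrix.vecMulVec_eq Unit, Matrix.det_one_add_replicateCol_mul_replicateRow]
        have := hu i₀
        simp only [PiLp.inner_apply, RCLike.inner_apply, conj_trivial] at this
        simp only [dotProduct]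
        rw [show ∑ a, u a * (t * v i₀ a) = t * ∑ a, v i₀ a * u a by
          rw [Finset.mul_sum]; exact Finset.sum_congr rfl fun _ _ => by ring, this]
        simp⟩
    rw [← hZ.image_simplexOf hd hv (φ := φ) (w := v) fun i => by
      rw [show (φ : Matrix (Fin n) (Fin n) ℝ) = _ from rfl, hact, hu]; simp]
    exact ⟨z, hz, hact t z⟩
  by_contra h
  obtain ⟨C, hC⟩ := (hZ.isConvexBody0 _ (hv.isSimplex0 hd)).1.isBounded.exists_norm_le
  have hpos : 0 < ‖v i₀‖ := norm_pos_iff.2 (hv.ne_zero _)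
  have h1 := hC _ hz
  have h2 := hC _ (hmem ((2 * C + 1) / ‖v i₀‖ / ⟪u, z⟫))
  rw [div_mul_cancel₀ _ h] at h2
  have h3 := norm_sub_le (z + ((2 * C + 1) / ‖v i₀‖) • v i₀) z
  have hC0 : 0 ≤ C := (norm_nonneg _).trans h1
  rw [add_sub_cancel_left, norm_smul, Real.norm_of_nonneg (by positivity),
    div_mul_cancel₀ _ hpos.ne'] at h3
  linarith

lemma supp_eq_of_lt (hZ : IsCovariantValuation Z) (hd : 1 ≤ d) (hdn : d < n)
    {v w : Fin d → Euc n} (hv : LinearIndependent ℝ v) (hw : LinearIndependent ℝ w) {x y : Euc n}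
    (h : ∀ i, ⟪x, v i⟫ = ⟪y, w i⟫) : supp (Z (simplexOf v)) x = supp (Z (simplexOf w)) y := by
  obtain ⟨φ, hφ⟩ := exists_specialLinearGroup_map hdn hv hw
  rw [← hZ.image_simplexOf hd hv hφ, supp_matAct, supp, supp]
  congr 1
  refine Set.image_congr fun z hz => ?_
  rw [← sub_eq_zero, ← inner_sub_left]
  refine hZ.inner_eq_zero hd hv (fun i => ?_) hz
  rw [inner_sub_left, ← inner_toEuclideanLin, hφ, h, sub_self]

lemma supp_eq_of_det_eq (hZ : IsCovariantValuation Z) (hn : 1 ≤ n)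
    {v w : Fin n → Euc n} (hv : LinearIndependent ℝ v)
    (hdet : (colMatrix v).det = (colMatrix w).det) {x y : Euc n}
    (h : ∀ i, ⟪x, v i⟫ = ⟪y, w i⟫) : supp (Z (simplexOf v)) x = supp (Z (simplexOf w)) y := by
  obtain ⟨A, hA, hAdet⟩ := exists_matrix_map hv w
  have hv0 := det_colMatrix_ne_zero hv
  let φ : Matrix.SpecialLinearGroup (Fin n) ℝ :=
    ⟨A, mul_right_cancel₀ hv0 (by rw [hAdet, hdet, one_mul])⟩
  rw [← hZ.image_simplexOf hn hv (φ := φ) hA, supp_matAct]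
  congr 1
  refine hv.ext_inner fun i => ?_
  rw [← inner_toEuclideanLin, h, show (φ : Matrix (Fin n) (Fin n) ℝ) = A from rfl, hA]

end IsCovariantValuation

end Reduction

/-! ### Functional equations -/

section FunctionalEquations

variable {n d : ℕ} {Z : Set (Euc n) → Set (Euc n)}

/-- The properties of support functions of convex bodies containing the origin. -/
structure IsSublinear (F : (Fin d → ℝ) → ℝ) : Prop where
  nonneg : ∀ s, 0 ≤ F s
  add_le : ∀ s t, F (s + t) ≤ F s + F t
  smul : ∀ c : ℝ, 0 ≤ c → ∀ s, F (c • s) = c * F s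
  continuous : Continuous F

lemma IsConvexBody0.isSublinear {K : Set (Euc n)} (hK : IsConvexBody0 K)
    (L : (Fin d → ℝ) →ₗ[ℝ] Euc n) : IsSublinear fun s => supp K (L s) where
  nonneg s := supp_nonneg hK.1 hK.2.2 _
  add_le s t := by
    rw [map_add]
    exact supp_add_le hK.1 ⟨0, hK.2.2⟩ _ _
  smul c hc s := by rw [map_smul, supp_smul _ hc]
  continuous := (continuous_supp hK.1).comp L.continuous_of_finiteDimensional

lemma exists_linearIndependent_of_le (hd : d ≤ n) :
    ∃ v : Fin d → Euc n, LinearIndependent ℝ v :=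
  ⟨_, (EuclideanSpace.basisFun (Fin n) ℝ).toBasis.linearIndependent.comp _
    (Fin.castLE_injective hd)⟩

lemma exists_det_colMatrix_eq (hn : 1 ≤ n) {δ : ℝ} (hδ : δ ≠ 0) :
    ∃ v : Fin n → Euc n, LinearIndependent ℝ v ∧ (colMatrix v).det = δ := by
  obtain ⟨v, hv⟩ := exists_linearIndependent_of_le (le_refl n)
  have h0 := det_colMatrix_ne_zero hv
  let c : Fin n → ℝˣ := Function.update 1 ⟨0, hn⟩ (Units.mk0 (δ / (colMatrix v).det)
    (div_ne_zero hδ h0))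
  have hc : c • v = Function.update v ⟨0, hn⟩ ((δ / (colMatrix v).det) • v ⟨0, hn⟩) := by
    ext1 i
    by_cases hi : i = ⟨0, hn⟩
    · subst hi; simp [c, Units.smul_def]
    · simp [c, hi]
  refine ⟨c • v, hv.units_smul c, ?_⟩
  rw [hc, det_colMatrix_update_smul, div_mul_cancel₀ _ h0]

/-- On `d`-dimensional simplices, the support function of `Z` is given by `F`. -/
def Represents (Z : Set (Euc n) → Set (Euc n)) (F : (Fin d → ℝ) → ℝ) : Prop :=
  ∀ v : Fin d → Euc n, LinearIndependent ℝ v → ∀ x,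
    supp (Z (simplexOf v)) x = F fun i => ⟪x, v i⟫

/-- On positively oriented full-dimensional simplices of volume `δ / n!`, the support function
of `Z` is given by `G δ`. -/
def RepresentsTop (Z : Set (Euc n) → Set (Euc n)) (G : ℝ → (Fin n → ℝ) → ℝ) : Prop :=
  ∀ v : Fin n → Euc n, LinearIndependent ℝ v → 0 < (colMatrix v).det → ∀ x,
    supp (Z (simplexOf v)) x = G (colMatrix v).det fun i => ⟪x, v i⟫

lemma IsCovariantValuation.exists_represents (hZ : IsCovariantValuation Z) (hd : 1 ≤ d)
    (hdn : d < n) : ∃ F : (Fin d → ℝ) → ℝ, Represents Z F := by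
  obtain ⟨w, hw⟩ := exists_linearIndependent_of_le hdn.le
  obtain ⟨L, hL⟩ := hw.exists_dual
  exact ⟨fun s => supp (Z (simplexOf w)) (L s), fun v hv x =>
    hZ.supp_eq_of_lt hd hdn hv hw fun i => by rw [hL]⟩

lemma IsCovariantValuation.exists_representsTop (hZ : IsCovariantValuation Z) (hn : 1 ≤ n) :
    ∃ G : ℝ → (Fin n → ℝ) → ℝ, RepresentsTop Z G := by
  have h (δ : ℝ) : ∃ F : (Fin n → ℝ) → ℝ, ∀ v : Fin n → Euc n, LinearIndependent ℝ v →
      0 < (colMatrix v).det → (colMatrix v).det = δ → ∀ x,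
      supp (Z (simplexOf v)) x = F fun i => ⟪x, v i⟫ := by
    by_cases hδ : δ = 0
    · exact ⟨0, fun v hv hpos h => absurd (h.trans hδ) hpos.ne'⟩
    · obtain ⟨w, hw, hdet⟩ := exists_det_colMatrix_eq hn hδ
      obtain ⟨L, hL⟩ := hw.exists_dual
      exact ⟨fun s => supp (Z (simplexOf w)) (L s), fun v hv _ h x =>
        hZ.supp_eq_of_det_eq hn hv (h.trans hdet.symm) fun i => by rw [hL]⟩
  choose G hG using h
  exact ⟨G, fun v hv hpos x => hG _ v hv hpos rfl x⟩

lemma Represents.isSublinear {F : (Fin d → ℝ) → ℝ} (hF : Represents Z F)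
    (hZ : IsCovariantValuation Z) (hd : 1 ≤ d) (hdn : d ≤ n) : IsSublinear F := by
  obtain ⟨w, hw⟩ := exists_linearIndependent_of_le hdn
  obtain ⟨L, hL⟩ := hw.exists_dual
  convert (hZ.isConvexBody0 _ (hw.isSimplex0 hd)).isSublinear L with s
  rw [hF w hw]
  congr 1
  exact funext fun i => (hL s i).symm

lemma Represents.comp_perm {F : (Fin d → ℝ) → ℝ} (hF : Represents Z F) (hdn : d ≤ n)
    (s : Fin d → ℝ) (σ : Equiv.Perm (Fin d)) : F (s ∘ σ) = F s := by
  obtain ⟨w, hw⟩ := exists_linearIndependent_of_le hdn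
  obtain ⟨L, hL⟩ := hw.exists_dual
  have h1 := hF w hw (L s)
  have h2 := hF (w ∘ σ) (hw.comp _ σ.injective) (L s)
  rw [simplexOf_comp_perm, h1] at h2
  simp only [Function.comp_def, hL] at h2
  exact h2.symm

lemma IsCovariantValuation.supp_add_supp {m : ℕ} (hZ : IsCovariantValuation Z) (hm : 1 ≤ m)
    {v : Fin (m + 1) → Euc n} (hv : LinearIndependent ℝ v) {i j : Fin (m + 1)} (hij : i ≠ j)
    {τ : ℝ} (hτ : 0 < τ) (hτ1 : τ < 1) (x : Euc n) :
    supp (Z (simplexOf v)) x +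
        supp (Z (simplexOf (Function.update v i (edgePoint v i j τ) ∘ j.succAbove))) x =
      supp (Z (simplexOf (Function.update v j (edgePoint v i j τ)))) x +
        supp (Z (simplexOf (Function.update v i (edgePoint v i j τ)))) x := by
  have hA := hv.update_edgePoint hij hτ.ne'
  have hB := hv.update_edgePoint' hij hτ1.ne
  have hs := hv.isSimplex0 (by omega)
  have hsA := hA.isSimplex0 (by omega)
  have hsB := hB.isSimplex0 (by omega)
  have hsC := (hB.comp _ j.succAbove_right_injective).isSimplex0 hm
  have h := hZ.add_inter _ _ hsA hsB
  rw [simplexOf_update_union hv hij hτ hτ1, simplexOf_update_inter_self hv hij hτ hτ1] at h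
  have hne {T : Set (Euc n)} (hT : IsSimplex0 T) : (Z T).Nonempty :=
    ⟨0, (hZ.isConvexBody0 T hT).2.2⟩
  have hc {T : Set (Euc n)} (hT : IsSimplex0 T) : IsCompact (Z T) := (hZ.isConvexBody0 T hT).1
  rw [← supp_add_set (hc hs) (hc hsC) (hne hs) (hne hsC), h hs hsC,
    supp_add_set (hc hsA) (hc hsB) (hne hsA) (hne hsB)]

lemma Represents.cut {m : ℕ} {F : (Fin (m + 1) → ℝ) → ℝ} {F' : (Fin m → ℝ) → ℝ}
    (hF : Represents Z F) (hF' : Represents Z F') (hZ : IsCovariantValuation Z) (hm : 1 ≤ m)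
    (hmn : m < n) (s : Fin (m + 1) → ℝ) {i j : Fin (m + 1)} (hij : i ≠ j)
    {τ : ℝ} (hτ : 0 < τ) (hτ1 : τ < 1) :
    F s + F' (Function.update s i (edgePoint s i j τ) ∘ j.succAbove) =
      F (Function.update s j (edgePoint s i j τ)) +
        F (Function.update s i (edgePoint s i j τ)) := by
  obtain ⟨v, hv⟩ := exists_linearIndependent_of_le (n := n) (d := m + 1) hmn
  obtain ⟨L, hL⟩ := hv.exists_dual
  have hA := hv.update_edgePoint hij hτ.ne'
  have hB := hv.update_edgePoint' hij hτ1.ne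
  have h := hZ.supp_add_supp hm hv hij hτ hτ1 (L s)
  rw [hF v hv, hF _ hA, hF _ hB, hF' _ (hB.comp _ j.succAbove_right_injective)] at h
  have hcomp : (fun k => ⟪L s, (Function.update v i (edgePoint v i j τ) ∘ j.succAbove) k⟫) =
    (fun k => ⟪L s, Function.update v i (edgePoint v i j τ) k⟫) ∘ j.succAbove := rfl
  rw [hcomp] at h
  simpa only [inner_update, inner_edgePoint, hL] using h

lemma RepresentsTop.isSublinear {G : ℝ → (Fin n → ℝ) → ℝ} (hG : RepresentsTop Z G)
    (hZ : IsCovariantValuation Z) (hn : 1 ≤ n) {δ : ℝ} (hδ : 0 < δ) : IsSublinear (G δ) := by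
  obtain ⟨w, hw, rfl⟩ := exists_det_colMatrix_eq hn hδ.ne'
  obtain ⟨L, hL⟩ := hw.exists_dual
  convert (hZ.isConvexBody0 _ (hw.isSimplex0 hn)).isSublinear L with s
  rw [hG w hw hδ]
  congr 1
  exact funext fun i => (hL s i).symm

lemma RepresentsTop.cut {m : ℕ} {Z : Set (Euc (m + 1)) → Set (Euc (m + 1))}
    {G : ℝ → (Fin (m + 1) → ℝ) → ℝ} {F' : (Fin m → ℝ) → ℝ}
    (hG : RepresentsTop Z G) (hF' : Represents Z F') (hZ : IsCovariantValuation Z) (hm : 1 ≤ m)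
    {δ : ℝ} (hδ : 0 < δ) (s : Fin (m + 1) → ℝ) {i j : Fin (m + 1)} (hij : i ≠ j)
    {τ : ℝ} (hτ : 0 < τ) (hτ1 : τ < 1) :
    G δ s + F' (Function.update s i (edgePoint s i j τ) ∘ j.succAbove) =
      G (τ * δ) (Function.update s j (edgePoint s i j τ)) +
        G ((1 - τ) * δ) (Function.update s i (edgePoint s i j τ)) := by
  obtain ⟨v, hv, rfl⟩ := exists_det_colMatrix_eq (n := m + 1) (by omega) hδ.ne'
  obtain ⟨L, hL⟩ := hv.exists_dual
  have hA := hv.update_edgePoint hij hτ.ne'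
  have hB := hv.update_edgePoint' hij hτ1.ne
  have h := hZ.supp_add_supp hm hv hij hτ hτ1 (L s)
  have hτ2 : 0 < 1 - τ := by linarith
  rw [hG v hv hδ, hG _ hA (by rw [det_colMatrix_update_edgePoint v hij]; positivity),
    hG _ hB (by rw [det_colMatrix_update_edgePoint' v hij]; positivity),
    hF' _ (hB.comp _ j.succAbove_right_injective), det_colMatrix_update_edgePoint v hij,
    det_colMatrix_update_edgePoint' v hij] at h
  have hcomp : (fun k => ⟪L s, (Function.update v i (edgePoint v i j τ) ∘ j.succAbove) k⟫) =
    (fun k => ⟪L s, Function.update v i (edgePoint v i j τ) k⟫) ∘ j.succAbove := rfl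
  rw [hcomp] at h
  simpa only [inner_update, inner_edgePoint, hL] using h

end FunctionalEquations

/-! ### Determination on lower-dimensional simplices -/

section LowerDimensional

variable {n d : ℕ} {a₁ a₂ b₁ b₂ : ℝ}

lemma exists_edgePoint_eq {s : Fin d → ℝ} {i j : Fin d} {r : ℝ} (h1 : s i < r) (h2 : r < s j) :
    ∃ τ : ℝ, 0 < τ ∧ τ < 1 ∧ edgePoint s i j τ = r := by
  have h : 0 < s j - s i := by linarith
  refine ⟨(r - s i) / (s j - s i), div_pos (by linarith) h, (div_lt_one h).2 (by linarith), ?_⟩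
  simp only [edgePoint, smul_eq_mul]
  field_simp
  ring

lemma exists_eq_or_between (hd : 3 ≤ d) (s : Fin d → ℝ) :
    (∃ i j, i ≠ j ∧ s i = s j) ∨ ∃ i j k, i ≠ k ∧ j ≠ k ∧ s i < s k ∧ s k < s j := by
  let p : Fin d := ⟨0, by omega⟩
  let q : Fin d := ⟨1, by omega⟩
  let r : Fin d := ⟨2, by omega⟩
  have hpq : p ≠ q := by simp [p, q]
  have hpr : p ≠ r := by simp [p, r]
  have hqr : q ≠ r := by simp [q, r]
  rcases lt_trichotomy (s p) (s q) with h1 | h1 | h1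
  · rcases lt_trichotomy (s q) (s r) with h2 | h2 | h2
    · exact .inr ⟨p, r, q, hpq, hqr.symm, h1, h2⟩
    · exact .inl ⟨q, r, hqr, h2⟩
    · rcases lt_trichotomy (s p) (s r) with h3 | h3 | h3
      · exact .inr ⟨p, q, r, hpr, hqr, h3, h2⟩
      · exact .inl ⟨p, r, hpr, h3⟩
      · exact .inr ⟨r, q, p, hpr.symm, hpq.symm, h3, h1⟩
  · exact .inl ⟨p, q, hpq, h1⟩
  · rcases lt_trichotomy (s p) (s r) with h2 | h2 | h2
    · exact .inr ⟨q, r, p, hpq.symm, hpr.symm, h1, h2⟩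
    · exact .inl ⟨p, r, hpr, h2⟩
    · rcases lt_trichotomy (s q) (s r) with h3 | h3 | h3
      · exact .inr ⟨q, p, r, hqr, hpr, h3, h2⟩
      · exact .inl ⟨q, r, hqr, h3⟩
      · exact .inr ⟨r, p, q, hqr.symm, hpq, h3, h1⟩

/-- A property that holds whenever two coordinates agree, and holds for `s` if it holds after
replacing either of two coordinates by a value strictly between them, always holds. -/
lemma forall_of_eq_of_cut (hd : 3 ≤ d) {Q : (Fin d → ℝ) → Prop}
    (heq : ∀ s i j, i ≠ j → s i = s j → Q s)
    (hcut : ∀ s i j τ, i ≠ j → 0 < τ → τ < 1 → Q (Function.update s j (edgePoint s i j τ)) →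
      Q (Function.update s i (edgePoint s i j τ)) → Q s) (s : Fin d → ℝ) : Q s := by
  rcases exists_eq_or_between hd s with ⟨i, j, hij, h⟩ | ⟨i, j, k, hik, hjk, h1, h2⟩
  · exact heq s i j hij h
  · have hij : i ≠ j := fun h => by subst h; linarith
    obtain ⟨τ, hτ, hτ1, hr⟩ := exists_edgePoint_eq h1 h2
    refine hcut s i j τ hij hτ hτ1 (heq _ j k hjk ?_) (heq _ i k hik ?_)
    · simp [hr, hjk.symm]
    · simp [hr, hik.symm]

lemma update_edgePoint_of_eq {s : Fin d → ℝ} {i j : Fin d} (h : s i = s j) (τ : ℝ) :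
    Function.update s j (edgePoint s i j τ) = s ∧ Function.update s i (edgePoint s i j τ) = s := by
  have hr : edgePoint s i j τ = s j := by
    simp only [edgePoint, smul_eq_mul, h]
    ring
  exact ⟨by rw [hr, Function.update_eq_self], by rw [hr, ← h, Function.update_eq_self]⟩

/-- The functional equation satisfied by the functions representing a valuation. -/
def IsCut {m : ℕ} (F : (Fin (m + 1) → ℝ) → ℝ) (F' : (Fin m → ℝ) → ℝ) : Prop :=
  ∀ (s : Fin (m + 1) → ℝ) (i j : Fin (m + 1)) (τ : ℝ), i ≠ j → 0 < τ → τ < 1 →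
    F s + F' (Function.update s i (edgePoint s i j τ) ∘ j.succAbove) =
      F (Function.update s j (edgePoint s i j τ)) + F (Function.update s i (edgePoint s i j τ))

lemma IsCut.eq_of_eq {m : ℕ} {F : (Fin (m + 1) → ℝ) → ℝ}
    (h : IsCut F (bodyFun a₁ a₂ b₁ b₂ : (Fin m → ℝ) → ℝ)) {s : Fin (m + 1) → ℝ}
    {i j : Fin (m + 1)} (hij : i ≠ j) (hs : s i = s j) : F s = bodyFun a₁ a₂ b₁ b₂ s := by
  have h1 := h s i j (1 / 2) hij (by norm_num) (by norm_num)
  have h2 := bodyFun_update_self (a₁ := a₁) (a₂ := a₂) (b₁ := b₁) (b₂ := b₂) (s := s) hij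
    (τ := 1 / 2) (by norm_num) (by norm_num)
  rw [(update_edgePoint_of_eq hs _).1, (update_edgePoint_of_eq hs _).2] at h1 h2
  linarith

lemma IsCut.eq_bodyFun {m : ℕ} (hm : 2 ≤ m) {F : (Fin (m + 1) → ℝ) → ℝ}
    (h : IsCut F (bodyFun a₁ a₂ b₁ b₂ : (Fin m → ℝ) → ℝ)) : F = bodyFun a₁ a₂ b₁ b₂ := by
  ext s
  refine forall_of_eq_of_cut (by omega) (fun s i j hij hs => h.eq_of_eq hij hs)
    (fun s i j τ hij hτ hτ1 hA hB => ?_) s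
  have h1 := h s i j τ hij hτ hτ1
  have h2 := bodyFun_update_self (a₁ := a₁) (a₂ := a₂) (b₁ := b₁) (b₂ := b₂) (s := s) hij
    hτ.le hτ1.le
  linarith

lemma IsSublinear.eq_bodyFun_one {F : (Fin 1 → ℝ) → ℝ} (hF : IsSublinear F) (a₂ b₂ : ℝ) :
    F = bodyFun (F fun _ => 1) a₂ (F fun _ => -1) b₂ := by
  ext s
  obtain ⟨r, rfl⟩ : ∃ r, s = fun _ => r := ⟨s 0, funext fun i => by rw [Subsingleton.elim i 0]⟩
  rw [bodyFun_const]
  rcases le_total 0 r with hr | hr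
  · have := hF.smul r hr fun _ => 1
    rw [show (r • fun _ : Fin 1 => (1 : ℝ)) = fun _ => r by ext; simp] at this
    rw [this, max_eq_left hr, max_eq_right (by linarith)]
    ring
  · have := hF.smul (-r) (by linarith) fun _ => -1
    rw [show (-r • fun _ : Fin 1 => (-1 : ℝ)) = fun _ => r by ext; simp] at this
    rw [this, max_eq_right hr, max_eq_left (by linarith)]
    ring

lemma bodyFun_pair {s t : ℝ} (h : s ≤ t) : bodyFun a₁ a₂ b₁ b₂ ![s, t] =
    a₂ * max t 0 - (b₂ - b₁) * max (-t) 0 + b₂ * max (-s) 0 - (a₂ - a₁) * max s 0 := by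
  rw [bodyFun_eq_of_bounds (i := 1) (j := 0)] <;> simp [Fin.forall_fin_two, h]

lemma IsCut.pair {F : (Fin 2 → ℝ) → ℝ} {F' : (Fin 1 → ℝ) → ℝ} (h : IsCut F F') {s r t : ℝ}
    (h1 : s < r) (h2 : r < t) : F ![s, t] + F' (fun _ => r) = F ![s, r] + F ![r, t] := by
  obtain ⟨τ, hτ, hτ1, hr⟩ := exists_edgePoint_eq (s := ![s, t]) (i := 0) (j := 1) h1 h2
  have := h ![s, t] 0 1 τ (by simp) hτ hτ1
  rw [hr] at this
  convert this using 3
  · ext i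
    rw [Subsingleton.elim i 0]
    simp
  · ext i
    fin_cases i <;> simp
  · ext i
    fin_cases i <;> simp

lemma IsCut.eq_bodyFun_two {F : (Fin 2 → ℝ) → ℝ} (hF : IsSublinear F)
    (hperm : ∀ s (σ : Equiv.Perm (Fin 2)), F (s ∘ σ) = F s)
    (h : IsCut F (bodyFun a₁ (F ![0, 1]) b₁ (F ![-1, 0]) : (Fin 1 → ℝ) → ℝ)) :
    F = bodyFun a₁ (F ![0, 1]) b₁ (F ![-1, 0]) := by
  have hpos {t : ℝ} (ht : 0 ≤ t) : F ![0, t] = t * F ![0, 1] := by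
    rw [← hF.smul t ht]
    simp
  have hneg {t : ℝ} (ht : t ≤ 0) : F ![t, 0] = -t * F ![-1, 0] := by
    rw [← hF.smul (-t) (by linarith)]
    simp
  have key {s t : ℝ} (hst : s ≤ t) :
      F ![s, t] = bodyFun a₁ (F ![0, 1]) b₁ (F ![-1, 0]) ![s, t] := by
    rcases hst.eq_or_lt with rfl | hst
    · exact h.eq_of_eq (i := 0) (j := 1) (by simp) (by simp)
    rw [bodyFun_pair hst.le]
    rcases lt_trichotomy 0 s with hs | rfl | hs
    · have := h.pair hs hst
      rw [bodyFun_const, hpos hs.le, hpos (hs.trans hst).le, max_eq_left hs.le,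
        max_eq_right (by linarith)] at this
      rw [max_eq_left (hs.trans hst).le, max_eq_right (by linarith), max_eq_right (by linarith),
        max_eq_left hs.le]
      linarith
    · rw [hpos hst.le, max_eq_left hst.le, max_eq_right (by linarith)]
      simp
      ring
    · rcases lt_trichotomy 0 t with ht | rfl | ht
      · have := h.pair hs ht
        rw [bodyFun_const, hneg hs.le, hpos ht.le] at this
        rw [max_eq_left ht.le, max_eq_right (by linarith), max_eq_left (by linarith),
          max_eq_right hs.le]
        simp at this
        linarith
      · rw [hneg hs.le, max_eq_left (by linarith : 0 ≤ -s), max_eq_right hs.le]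
        simp
        ring
      · have := h.pair hst ht
        rw [bodyFun_const, hneg hs.le, hneg ht.le, max_eq_right ht.le,
          max_eq_left (by linarith)] at this
        rw [max_eq_right ht.le, max_eq_left (by linarith), max_eq_left (by linarith),
          max_eq_right hs.le]
        linarith
  ext s
  have hs : s = ![s 0, s 1] := by ext i; fin_cases i <;> rfl
  rcases le_total (s 0) (s 1) with h01 | h01
  · rw [hs]
    exact key h01
  · have hs' : s ∘ Equiv.swap 0 1 = ![s 1, s 0] := by ext i; fin_cases i <;> simp
    rw [← hperm s (Equiv.swap 0 1), ← bodyFun_comp_perm s (Equiv.swap 0 1), hs']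
    exact key h01

variable {Z : Set (Euc n) → Set (Euc n)}

lemma IsCovariantValuation.exists_represents_bodyFun (hZ : IsCovariantValuation Z) (hn : 3 ≤ n) :
    ∃ a₁ a₂ b₁ b₂ : ℝ, 0 ≤ a₁ ∧ 0 ≤ a₂ ∧ 0 ≤ b₁ ∧ 0 ≤ b₂ ∧ a₂ - a₁ ≤ b₂ ∧ b₂ - b₁ ≤ a₂ ∧
      ∀ d, 1 ≤ d → d < n → Represents Z (bodyFun a₁ a₂ b₁ b₂ : (Fin d → ℝ) → ℝ) := by
  obtain ⟨F₁, h₁⟩ := hZ.exists_represents (d := 1) le_rfl (by omega)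
  obtain ⟨F₂, h₂⟩ := hZ.exists_represents (d := 2) (by norm_num) (by omega)
  have s₁ := h₁.isSublinear hZ le_rfl (by omega)
  have s₂ := h₂.isSublinear hZ (by norm_num) (by omega)
  have e₁ := s₁.eq_bodyFun_one (F₂ ![0, 1]) (F₂ ![-1, 0])
  set a₁ := F₁ fun _ => 1
  set b₁ := F₁ fun _ => -1
  have ha₁ : 0 ≤ a₁ := s₁.nonneg _
  have hb₁ : 0 ≤ b₁ := s₁.nonneg _
  rw [e₁] at h₁
  have e₂ := IsCut.eq_bodyFun_two s₂ (h₂.comp_perm (by omega)) fun s i j τ hij hτ hτ1 =>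
    h₂.cut h₁ hZ le_rfl (by omega) s hij hτ hτ1
  set a₂ := F₂ ![0, 1]
  set b₂ := F₂ ![-1, 0]
  have ha₂ : 0 ≤ a₂ := s₂.nonneg _
  have hb₂ : 0 ≤ b₂ := s₂.nonneg _
  rw [e₂] at h₂ s₂
  refine ⟨a₁, a₂, b₁, b₂, ha₁, ha₂, hb₁, hb₂, ?_, ?_, fun d hd => ?_⟩
  · have h1 := s₂.add_le ![1, 1] ![-1, 1]
    have h2 := s₂.smul 2 (by norm_num) ![0, 1]
    rw [show ![1, 1] + ![-1, 1] = (2 : ℝ) • ![(0 : ℝ), 1] by ext i; fin_cases i <;> norm_num, h2,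
      bodyFun_pair (by norm_num), bodyFun_pair (by norm_num), bodyFun_pair (by norm_num)] at h1
    norm_num at h1
    linarith
  · have h1 := s₂.add_le ![-1, -1] ![-1, 1]
    have h2 := s₂.smul 2 (by norm_num) ![-1, 0]
    rw [show ![-1, -1] + ![-1, 1] = (2 : ℝ) • ![(-1 : ℝ), 0] by ext i; fin_cases i <;> norm_num,
      h2, bodyFun_pair (by norm_num), bodyFun_pair (by norm_num),
      bodyFun_pair (by norm_num)] at h1
    norm_num at h1
    linarith
  · induction d, hd using Nat.le_induction with
    | base => exact fun _ => h₁
    | succ m hm ih =>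
      intro hmn
      rcases hm.eq_or_lt with rfl | hm2
      · exact h₂
      · obtain ⟨F, hF⟩ := hZ.exists_represents (d := m + 1) (by omega) hmn
        have := IsCut.eq_bodyFun hm2 fun s i j τ hij hτ hτ1 =>
          hF.cut (ih (by omega)) hZ hm (by omega) s hij hτ hτ1
        rwa [this] at hF

end LowerDimensional

/-! ### Real functions that are affine along edges -/

section EdgeAffine

variable {d : ℕ}

/-- An additive function on the positive half-line that is bounded below is nonnegative and
linear. -/
lemma nonneg_and_linear_of_additive {f : ℝ → ℝ} {C : ℝ}
    (hadd : ∀ x y, 0 < x → 0 < y → f (x + y) = f x + f y) (hC : ∀ x, 0 < x → -C ≤ f x) :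
    (∀ x, 0 < x → 0 ≤ f x) ∧ ∀ x, 0 < x → f x = x * f 1 := by
  have hmul (N : ℕ) {x : ℝ} (hx : 0 < x) : f ((N + 1 : ℕ) * x) = (N + 1 : ℕ) * f x := by
    induction N with
    | zero => simp
    | succ N ih =>
      rw [Nat.cast_succ, add_one_mul, hadd _ _ (by positivity) hx, ih]
      push_cast
      ring
  have hnonneg (x : ℝ) (hx : 0 < x) : 0 ≤ f x := by
    by_contra! h
    obtain ⟨N, hN⟩ := exists_nat_gt (C / -f x)
    rw [div_lt_iff₀ (by linarith)] at hN
    have h1 := hmul N hx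
    have h2 := hC ((N + 1 : ℕ) * x) (by positivity)
    rw [h1] at h2
    push_cast at h2
    linarith
  have hmono {x y : ℝ} (hx : 0 < x) (hxy : x ≤ y) : f x ≤ f y := by
    rcases hxy.eq_or_lt with rfl | hlt
    · exact le_rfl
    · have := hadd x (y - x) hx (by linarith)
      rw [add_sub_cancel] at this
      linarith [hnonneg (y - x) (by linarith)]
  refine ⟨hnonneg, fun x hx => ?_⟩
  have hbound (N : ℕ) : |(N + 1 : ℕ) * (f x - x * f 1)| ≤ f 1 := by
    have hpos : (0 : ℝ) < (N + 1 : ℕ) * x := by positivity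
    have h1 := hmul N hx
    have h2 := Nat.floor_le hpos.le
    have h3 := Nat.lt_floor_add_one ((N + 1 : ℕ) * x)
    have h4 := hmul ⌊(N + 1 : ℕ) * x⌋₊ one_pos
    have h5 := hmono hpos (y := (⌊(N + 1 : ℕ) * x⌋₊ + 1 : ℕ) * 1) (by push_cast at h3 ⊢; linarith)
    have hf1 := hnonneg 1 one_pos
    have h6 : ⌊(N + 1 : ℕ) * x⌋₊ * f 1 ≤ f ((N + 1 : ℕ) * x) := by
      rcases Nat.eq_zero_or_pos ⌊(N + 1 : ℕ) * x⌋₊ with h0 | h0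
      · rw [h0]
        simpa using hnonneg _ hpos
      · obtain ⟨M, hM⟩ := Nat.exists_eq_add_of_le' h0
        rw [hM] at h2 ⊢
        have := hmul M one_pos
        rw [mul_one] at this
        rw [← this]
        exact hmono (by positivity) h2
    rw [h4] at h5
    rw [h1] at h5 h6
    push_cast at *
    rw [abs_le]
    constructor <;> nlinarith
  by_contra h
  have hpos : 0 < |f x - x * f 1| := abs_pos.2 (sub_ne_zero.2 h)
  obtain ⟨N, hN⟩ := exists_nat_gt (f 1 / |f x - x * f 1|)
  rw [div_lt_iff₀ hpos] at hN
  have := hbound N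
  rw [abs_mul, Nat.abs_cast] at this
  push_cast at this
  linarith

lemma update_apply_eq_zero {s : Fin d → ℝ} {j l : Fin d} (hj : s j ≠ 0) (hl : s l = 0) (r : ℝ) :
    Function.update s j r l = 0 := by
  rw [Function.update_of_ne (by rintro rfl; exact hj hl), hl]

/-- Continuous, positively homogeneous functions that average along edges in the same way as the
moment body of a full-dimensional simplex. -/
structure IsEdgeAverage (e : (Fin d → ℝ) → ℝ) : Prop where
  continuous : Continuous e
  smul : ∀ c : ℝ, 0 ≤ c → ∀ s, e (c • s) = c * e s
  cut : ∀ (s : Fin d → ℝ) (i j : Fin d) (τ : ℝ), i ≠ j → 0 < τ → τ < 1 →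
    e s = τ * e (Function.update s j (edgePoint s i j τ)) +
      (1 - τ) * e (Function.update s i (edgePoint s i j τ))

namespace IsEdgeAverage

variable {e e' : (Fin d → ℝ) → ℝ}

lemma sub_const_mul (h : IsEdgeAverage e) (h' : IsEdgeAverage e') (c : ℝ) :
    IsEdgeAverage fun s => e s - c * e' s where
  continuous := h.continuous.sub (continuous_const.mul h'.continuous)
  smul r hr s := by
    rw [h.smul r hr, h'.smul r hr]
    ring
  cut s i j τ hij hτ hτ1 := by
    rw [h.cut s i j τ hij hτ hτ1, h'.cut s i j τ hij hτ hτ1]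
    ring

lemma comp_neg (h : IsEdgeAverage e) : IsEdgeAverage fun s => e (-s) where
  continuous := h.continuous.comp continuous_neg
  smul r hr s := by rw [← smul_neg, h.smul r hr]
  cut s i j τ hij hτ hτ1 := by
    have hr : edgePoint (-s) i j τ = -edgePoint s i j τ := by
      simp only [edgePoint, Pi.neg_apply, smul_eq_mul]
      ring
    have hu (k : Fin d) (r : ℝ) : -Function.update s k r = Function.update (-s) k (-r) := by
      ext l
      by_cases hl : l = k
      · subst hl; simp
      · simp [hl]
    rw [h.cut (-s) i j τ hij hτ hτ1, hr, hu, hu]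

lemma update_single (h : IsEdgeAverage e) {k l : Fin d} (hkl : k ≠ l) (c : ℝ) :
    e (Function.update (Pi.single k c) l c) = 2 * e (Pi.single k c) := by
  have hclosed : IsClosed {t : ℝ | e (Function.update (Pi.single k (t * c)) l c) =
      (t + 1) * e (Pi.single k c)} := by
    refine isClosed_eq (h.continuous.comp ?_) (by fun_prop)
    have : Continuous fun t : ℝ => (Pi.single k (t * c) : Fin d → ℝ) :=
      (continuous_single k).comp (by fun_prop)
    exact this.update l continuous_const
  have hsub : Set.Ioi 1 ⊆ {t : ℝ | e (Function.update (Pi.single k (t * c)) l c) =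
      (t + 1) * e (Pi.single k c)} := by
    intro t ht
    have ht1 : 1 < t := ht
    have h1 := h.cut (Pi.single k (t * c)) l k t⁻¹ hkl.symm (by positivity)
      (inv_lt_one_of_one_lt₀ ht1)
    have hr : edgePoint (Pi.single k (t * c)) l k t⁻¹ = c := by
      have : t ≠ 0 := by positivity
      simp [edgePoint, hkl.symm, this]
    have h2 := h.smul t (by positivity) (Pi.single k c)
    rw [← Pi.single_smul, smul_eq_mul] at h2
    have h3 : Function.update (Pi.single k (t * c)) k c = (Pi.single k c : Fin d → ℝ) := by
      simp [Pi.single]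
    rw [hr, h2, h3] at h1
    have h4 : (t - 1) * e (Function.update (Pi.single k (t * c)) l c) =
        (t - 1) * ((t + 1) * e (Pi.single k c)) := by
      field_simp at h1
      linear_combination -h1
    exact mul_left_cancel₀ (by linarith) h4
  have := hclosed.closure_subset_iff.2 hsub
    (show (1 : ℝ) ∈ _ by rw [closure_Ioi]; exact Set.self_mem_Ici)
  rw [Set.mem_ofPred_eq, one_mul] at this
  rw [this]
  ring

lemma single_eq_single (h : IsEdgeAverage e) (k l : Fin d) (c : ℝ) :
    e (Pi.single k c) = e (Pi.single l c) := by
  rcases eq_or_ne k l with rfl | hkl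
  · rfl
  · have h1 := h.update_single hkl c
    have h2 := h.update_single hkl.symm c
    have h3 : Function.update (Pi.single k c) l c =
        (Function.update (Pi.single l c) k c : Fin d → ℝ) := by
      simp only [Pi.single]
      rw [Function.update_comm hkl]
    rw [h3] at h1
    linarith

/-- If `s i` and `s j` are distinct and nonzero, then `e s` is determined by values of `e` at
points with fewer nonzero coordinates. -/
lemma eq_zero_of_ne (h : IsEdgeAverage e) {s : Fin d → ℝ} {i j : Fin d} (hs : s i ≠ s j)
    (hi : s i ≠ 0) (hj : s j ≠ 0)
    (hz : ∀ k t, (k = i ∨ k = j) → t k = 0 → (∀ l, s l = 0 → t l = 0) → e t = 0) : e s = 0 := by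
  wlog hle : |s i| ≤ |s j| generalizing i j
  · exact this hs.symm hj hi (fun k t hk => hz k t hk.symm) (not_le.1 hle).le
  have hij : i ≠ j := fun h => hs (by rw [h])
  rcases lt_or_ge (s i * s j) 0 with hneg | hpos
  · obtain ⟨τ, hτ, hτ1, hr⟩ : ∃ τ : ℝ, 0 < τ ∧ τ < 1 ∧ edgePoint s i j τ = 0 := by
      rcases mul_neg_iff.1 hneg with ⟨h1, h2⟩ | ⟨h1, h2⟩
      · obtain ⟨τ, hτ, hτ1, hr⟩ := exists_edgePoint_eq h2 h1
        exact ⟨1 - τ, by linarith, by linarith, by rw [← hr, edgePoint_symm s j i]⟩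
      · exact exists_edgePoint_eq h1 h2
    rw [h.cut s i j τ hij hτ hτ1, hr, hz j _ (.inr rfl), hz i _ (.inl rfl)]
    · simp
    · simp
    · exact fun l hl => update_apply_eq_zero hi hl _
    · simp
    · exact fun l hl => update_apply_eq_zero hj hl _
  · have hτ : 0 < s i / s j := by
      rw [← mul_div_mul_right _ _ hj]
      exact div_pos (lt_of_le_of_ne hpos (mul_ne_zero hi hj).symm) (mul_self_pos.2 hj)
    have hτ1 : s i / s j < 1 := by
      rw [← abs_of_pos hτ, abs_div, div_lt_one (abs_pos.2 hj)]
      refine lt_of_le_of_ne hle fun h => ?_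
      rcases abs_eq_abs.1 h with h | h
      · exact hs h
      · rw [h] at hpos
        nlinarith [mul_self_pos.2 hj]
    have h1 := h.cut (Function.update s i 0) i j _ hij hτ hτ1
    have hr : edgePoint (Function.update s i 0) i j (s i / s j) = s i := by
      simp [edgePoint, hij.symm, hj]
    rw [hr, hz i (Function.update s i 0) (.inl rfl), hz i _ (.inl rfl), Function.update_idem,
      Function.update_eq_self] at h1
    · rw [mul_zero, zero_add, zero_eq_mul] at h1
      exact h1.resolve_left (by linarith)
    · simp [hij]
    · intro l hl
      refine update_apply_eq_zero ?_ (update_apply_eq_zero hi hl _) _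
      rwa [Function.update_of_ne hij.symm]
    · simp
    · exact fun l hl => update_apply_eq_zero hi hl _

lemma eq_zero (h : IsEdgeAverage e) (k₀ : Fin d) (h1 : e (Pi.single k₀ 1) = 0)
    (h2 : e (Pi.single k₀ (-1)) = 0) (s : Fin d → ℝ) : e s = 0 := by
  obtain ⟨N, hN⟩ : ∃ N, (Finset.univ.filter fun k => s k ≠ 0).card = N := ⟨_, rfl⟩
  induction N using Nat.strong_induction_on generalizing s with
  | _ N ih =>
  have hlt {t s' : Fin d → ℝ} {k : Fin d} (hs' : ∀ l, s l = 0 → s' l = 0)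
      (hk : s k ≠ 0) (htk : t k = 0) (hl : ∀ l, s' l = 0 → t l = 0) : e t = 0 := by
    refine ih _ ?_ t rfl
    rw [← hN]
    refine Finset.card_lt_card ⟨fun l hl' => ?_, fun hsub => ?_⟩
    · simp only [Finset.mem_filter, Finset.mem_univ, true_and] at hl' ⊢
      exact fun h => hl' (hl l (hs' l h))
    · have := hsub (Finset.mem_filter.2 ⟨Finset.mem_univ k, hk⟩)
      simp [htk] at this
  by_cases hex : ∃ i j, i ≠ j ∧ s i ≠ 0 ∧ s j ≠ 0
  · obtain ⟨i, j, hij, hi, hj⟩ := hex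
    by_cases hs : s i = s j
    · have hclosed : IsClosed {ε : ℝ | e (Function.update s j ((1 + ε) * s j)) = 0} :=
        isClosed_eq (h.continuous.comp (continuous_const.update j (by fun_prop))) continuous_const
      have hsub : Set.Ioi 0 ⊆ {ε : ℝ | e (Function.update s j ((1 + ε) * s j)) = 0} := by
        intro ε hε
        have hε0 : 0 < ε := hε
        have hne : (1 + ε) * s j ≠ 0 := mul_ne_zero (by positivity) hj
        refine h.eq_zero_of_ne (i := i) (j := j) ?_ ?_ ?_ fun k t hk htk hl => ?_
        · rw [Function.update_of_ne hij, Function.update_self, hs]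
          intro h
          have : ε * s j = 0 := by linarith
          exact (mul_ne_zero hε0.ne' hj) this
        · rwa [Function.update_of_ne hij]
        · rwa [Function.update_self]
        · exact hlt (k := k) (fun l hl => update_apply_eq_zero hj hl _)
            (by rcases hk with rfl | rfl <;> assumption) htk hl
      have := hclosed.closure_subset_iff.2 hsub
        (show (0 : ℝ) ∈ _ by rw [closure_Ioi]; exact Set.self_mem_Ici)
      simpa using this
    · exact h.eq_zero_of_ne hs hi hj fun k t hk htk hl => hlt (k := k) (fun _ h => h)
        (by rcases hk with rfl | rfl <;> assumption) htk hl
  · by_cases hk : ∃ k, s k ≠ 0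
    · obtain ⟨k, hk⟩ := hk
      have hsk : s = Pi.single k (s k) := by
        ext l
        by_cases hl : l = k
        · subst hl; simp
        · rw [Pi.single_eq_of_ne hl]
          by_contra hl0
          exact hex ⟨l, k, hl, hl0, hk⟩
      rw [hsk]
      rcases le_total 0 (s k) with h0 | h0
      · have := h.smul _ h0 (Pi.single k 1)
        rw [← Pi.single_smul, smul_eq_mul, mul_one] at this
        rw [this, h.single_eq_single k k₀, h1, mul_zero]
      · have := h.smul (-s k) (by linarith) (Pi.single k (-1))
        rw [← Pi.single_smul, smul_eq_mul, neg_mul_neg, mul_one] at this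
        rw [this, h.single_eq_single k k₀, h2, mul_zero]
    · push Not at hk
      rw [show s = (0 : ℝ) • s by ext k; simp [hk k], h.smul 0 le_rfl, zero_mul]

end IsEdgeAverage

end EdgeAffine

/-! ### Determination on full-dimensional simplices -/

section FullDimensional

lemma mPlus1_simplexOf_update {m : ℕ} {v : Fin (m + 1) → Euc (m + 1)}
    (hv : LinearIndependent ℝ v) {i j : Fin (m + 1)} (hij : i ≠ j) {τ : ℝ} (hτ : 0 < τ)
    (hτ1 : τ < 1) (x : Euc (m + 1)) :
    mPlus1 (simplexOf v) x = mPlus1 (simplexOf (Function.update v j (edgePoint v i j τ))) x +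
      mPlus1 (simplexOf (Function.update v i (edgePoint v i j τ))) x := by
  rw [← mPlus1_union_add_inter (isCompact_simplexOf _) (isCompact_simplexOf _),
    simplexOf_update_union hv hij hτ hτ1, simplexOf_update_inter_self hv hij hτ hτ1,
    mPlus1_simplexOf_of_lt (Nat.lt_succ_self m), add_zero]

lemma mPlus1_simplexOf_pos {n : ℕ} {v : Fin n → Euc n} (hv : LinearIndependent ℝ v) {x : Euc n}
    {k : Fin n} (hx : ∀ i, ⟪x, v i⟫ = (Pi.single k 1 : Fin n → ℝ) i) :
    0 < mPlus1 (simplexOf v) x := by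
  obtain ⟨g, hg⟩ := exists_coordinates hv
  have hn : (0 : ℝ) < n := by exact_mod_cast k.pos
  have hspan (y : Euc n) : ∑ i, g y i • v i = y := by
    have hspan : Submodule.span ℝ (Set.range v) = ⊤ :=
      hv.span_eq_top_of_card_eq_finrank' (by simp)
    obtain ⟨t, rfl⟩ := (Submodule.mem_span_range_iff_exists_fun ℝ).1
      (hspan ▸ Submodule.mem_top : y ∈ Submodule.span ℝ (Set.range v))
    rw [hg]
  let U : Set (Euc n) := g ⁻¹' Set.univ.pi fun _ => Set.Ioo 0 (1 / (n : ℝ))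
  have hUo : IsOpen U := (isOpen_set_pi Set.finite_univ fun _ _ => isOpen_Ioo).preimage
    g.continuous_of_finiteDimensional
  have hUne : U.Nonempty := by
    refine ⟨∑ i, (1 / (2 * n) : ℝ) • v i, ?_⟩
    rw [Set.mem_preimage, hg fun _ => 1 / (2 * n)]
    intro i _
    constructor
    · positivity
    · rw [div_lt_div_iff₀ (by positivity) hn]
      linarith
  have hU : U ⊆ Function.support (fun y => max ⟪x, y⟫ 0) ∩ simplexOf v := by
    intro y hy
    have hy' : ∀ i, 0 < g y i ∧ g y i < 1 / n := fun i => hy i (Set.mem_univ i)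
    constructor
    · have : ⟪x, y⟫ = g y k := by
        rw [← hspan y, inner_sum, hg]
        simp [inner_smul_right, hx, Pi.single_apply]
      rw [Function.mem_support, this, max_eq_left (hy' k).1.le]
      exact (hy' k).1.ne'
    · rw [mem_simplexOf_iff_coordinates hg]
      refine ⟨fun i => (hy' i).1.le, ?_, (hspan y).symm⟩
      calc ∑ i, g y i ≤ ∑ _i : Fin n, 1 / (n : ℝ) :=
            Finset.sum_le_sum fun i _ => (hy' i).2.le
        _ = 1 := by simp [hn.ne']
  rw [mPlus1, setIntegral_pos_iff_support_of_nonneg_ae (f := fun y : Euc n => max ⟪x, y⟫ 0)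
    (Filter.Eventually.of_forall fun _ => le_max_right _ _)
    (integrableOn_moment (isCompact_simplexOf v) x)]
  exact (hUo.measure_pos volume hUne).trans_le (measure_mono hU)

lemma mPlus1_simplexOf_eq_zero {n d : ℕ} {v : Fin d → Euc n} {x : Euc n}
    (hx : ∀ i, ⟪x, v i⟫ ≤ 0) : mPlus1 (simplexOf v) x = 0 := by
  have hsub : simplexOf v ⊆ {y | ⟪x, y⟫ ≤ 0} :=
    simplexOf_subset_of_vertices_mem (convex_halfSpace_le (innerₛₗ ℝ x).isLinear 0)
      (by simp) hx
  rw [mPlus1, setIntegral_congr_fun (isCompact_simplexOf v).measurableSet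
    (g := fun _ => (0 : ℝ)) fun y hy => max_eq_right (hsub hy)]
  simp

lemma exists_momentFun (m : ℕ) : ∃ M : (Fin (m + 1) → ℝ) → ℝ, IsEdgeAverage M ∧
    (∀ v : Fin (m + 1) → Euc (m + 1), LinearIndependent ℝ v → ∀ x,
      mPlus1 (simplexOf v) x = |(colMatrix v).det| * M fun i => ⟪x, v i⟫) ∧
    0 < M (Pi.single 0 1) ∧ M (Pi.single 0 (-1)) = 0 := by
  obtain ⟨w, hw, hdet⟩ := exists_det_colMatrix_eq (n := m + 1) (by omega) one_ne_zero
  obtain ⟨L, hL⟩ := hw.exists_dual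
  have hrep (v : Fin (m + 1) → Euc (m + 1)) (x : Euc (m + 1)) (hv : LinearIndependent ℝ v) :
      mPlus1 (simplexOf v) x =
        |(colMatrix v).det| * mPlus1 (simplexOf w) (L fun i => ⟪x, v i⟫) := by
    obtain ⟨A, hA, hAdet⟩ := exists_matrix_map hw v
    rw [hdet, mul_one] at hAdet
    rw [← hAdet, ← funext hA, ← matAct_simplexOf,
      mPlus1_matAct (hAdet ▸ det_colMatrix_ne_zero hv) (isCompact_simplexOf w)]
    congr 2
    refine hw.ext_inner fun i => ?_
    rw [hL, ← inner_toEuclideanLin]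
  refine ⟨fun s => mPlus1 (simplexOf w) (L s), ⟨?_, fun c hc s => ?_, fun s i j τ hij hτ hτ1 => ?_⟩,
    fun v hv x => hrep v x hv, mPlus1_simplexOf_pos hw (hL _),
    mPlus1_simplexOf_eq_zero fun i => ?_⟩
  · exact (continuous_mPlus1 (isCompact_simplexOf w)).comp L.continuous_of_finiteDimensional
  · rw [map_smul, mPlus1_smul _ hc]
  · rw [mPlus1_simplexOf_update hw hij hτ hτ1, hrep _ _ (hw.update_edgePoint hij hτ.ne'),
      hrep _ _ (hw.update_edgePoint' hij hτ1.ne), det_colMatrix_update_edgePoint w hij,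
      det_colMatrix_update_edgePoint' w hij, hdet, mul_one, mul_one, abs_of_pos hτ,
      abs_of_pos (by linarith)]
    simp only [inner_update, inner_edgePoint, hL]
  · rw [hL]
    by_cases hi : i = 0
    · subst hi; simp
    · simp [hi]

variable {m : ℕ} {a₁ a₂ b₁ b₂ : ℝ} {G : ℝ → (Fin (m + 1) → ℝ) → ℝ}

/-- The functional equation satisfied by the functions representing a valuation on
full-dimensional simplices. -/
def IsTopCut (G : ℝ → (Fin (m + 1) → ℝ) → ℝ) (a₁ a₂ b₁ b₂ : ℝ) : Prop :=
  ∀ (δ : ℝ) (s : Fin (m + 1) → ℝ) (i j : Fin (m + 1)) (τ : ℝ), 0 < δ → i ≠ j → 0 < τ → τ < 1 →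
    G δ s - bodyFun a₁ a₂ b₁ b₂ s =
      (G (τ * δ) (Function.update s j (edgePoint s i j τ)) -
        bodyFun a₁ a₂ b₁ b₂ (Function.update s j (edgePoint s i j τ))) +
      (G ((1 - τ) * δ) (Function.update s i (edgePoint s i j τ)) -
        bodyFun a₁ a₂ b₁ b₂ (Function.update s i (edgePoint s i j τ)))

lemma IsTopCut.of_eq (h : IsTopCut G a₁ a₂ b₁ b₂) (hG : ∀ δ, 0 < δ → IsSublinear (G δ))
    {s : Fin (m + 1) → ℝ} {i j : Fin (m + 1)} (hij : i ≠ j) (hs : s i = s j) :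
    0 ≤ G 1 s - bodyFun a₁ a₂ b₁ b₂ s ∧ ∀ δ, 0 < δ →
      G δ s - bodyFun a₁ a₂ b₁ b₂ s = δ * (G 1 s - bodyFun a₁ a₂ b₁ b₂ s) := by
  have := nonneg_and_linear_of_additive (f := fun δ => G δ s - bodyFun a₁ a₂ b₁ b₂ s)
    (C := bodyFun a₁ a₂ b₁ b₂ s) (fun x y hx hy => ?_) fun x hx => by
      have := (hG x hx).nonneg s
      linarith
  · exact ⟨this.1 1 one_pos, this.2⟩
  · have hxy : 0 < x + y := by linarith
    have h1 := h (x + y) s i j (x / (x + y)) hxy hij (by positivity)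
      ((div_lt_one hxy).2 (by linarith))
    have h2 : (1 - x / (x + y)) * (x + y) = y := by field_simp; ring
    rwa [(update_edgePoint_of_eq hs _).1, (update_edgePoint_of_eq hs _).2,
      div_mul_cancel₀ _ hxy.ne', h2] at h1

lemma IsTopCut.linear (h : IsTopCut G a₁ a₂ b₁ b₂) (hG : ∀ δ, 0 < δ → IsSublinear (G δ))
    (hm : 2 ≤ m) (s : Fin (m + 1) → ℝ) : ∀ δ, 0 < δ →
      G δ s - bodyFun a₁ a₂ b₁ b₂ s = δ * (G 1 s - bodyFun a₁ a₂ b₁ b₂ s) := by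
  refine forall_of_eq_of_cut (by omega) (fun s i j hij hs => (h.of_eq hG hij hs).2)
    (fun s i j τ hij hτ hτ1 hA hB δ hδ => ?_) s
  have hτ2 : 0 < 1 - τ := by linarith
  rw [h δ s i j τ hδ hij hτ hτ1, h 1 s i j τ one_pos hij hτ hτ1, hA (τ * δ) (by positivity),
    hA (τ * 1) (by positivity), hB ((1 - τ) * δ) (by positivity), hB ((1 - τ) * 1) (by positivity)]
  ring

lemma IsTopCut.isEdgeAverage (h : IsTopCut G a₁ a₂ b₁ b₂) (hG : ∀ δ, 0 < δ → IsSublinear (G δ))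
    (hm : 2 ≤ m) : IsEdgeAverage fun s => G 1 s - bodyFun a₁ a₂ b₁ b₂ s where
  continuous := (hG 1 one_pos).continuous.sub continuous_bodyFun
  smul c hc s := by
    rw [(hG 1 one_pos).smul c hc, bodyFun_smul hc]
    ring
  cut s i j τ hij hτ hτ1 := by
    rw [h 1 s i j τ one_pos hij hτ hτ1,
      h.linear hG hm (Function.update s j (edgePoint s i j τ)) (τ * 1) (by linarith),
      h.linear hG hm (Function.update s i (edgePoint s i j τ)) ((1 - τ) * 1) (by linarith)]
    ring

lemma bodyFun_add_le_of_linear (hG : ∀ δ, 0 < δ → IsSublinear (G δ))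
    (hlin : ∀ s δ, 0 < δ →
      G δ s - bodyFun a₁ a₂ b₁ b₂ s = δ * (G 1 s - bodyFun a₁ a₂ b₁ b₂ s))
    (s t : Fin (m + 1) → ℝ) :
    bodyFun a₁ a₂ b₁ b₂ (s + t) ≤ bodyFun a₁ a₂ b₁ b₂ s + bodyFun a₁ a₂ b₁ b₂ t := by
  let e : (Fin (m + 1) → ℝ) → ℝ := fun s => G 1 s - bodyFun a₁ a₂ b₁ b₂ s
  have hle {δ : ℝ} (hδ : 0 < δ) : bodyFun a₁ a₂ b₁ b₂ (s + t) ≤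
      bodyFun a₁ a₂ b₁ b₂ s + bodyFun a₁ a₂ b₁ b₂ t + δ * (e s + e t - e (s + t)) := by
    have h0 := (hG δ hδ).add_le s t
    have h1 := hlin s δ hδ
    have h2 := hlin t δ hδ
    have h3 := hlin (s + t) δ hδ
    simp only [e]
    linarith
  have hclosed : IsClosed {δ : ℝ | bodyFun a₁ a₂ b₁ b₂ (s + t) ≤
      bodyFun a₁ a₂ b₁ b₂ s + bodyFun a₁ a₂ b₁ b₂ t + δ * (e s + e t - e (s + t))} :=
    isClosed_le continuous_const (by fun_prop)
  have := hclosed.closure_subset_iff.2 (fun δ (hδ : δ ∈ Set.Ioi 0) => hle hδ)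
    (show (0 : ℝ) ∈ _ by rw [closure_Ioi]; exact Set.self_mem_Ici)
  simpa using this

lemma le_of_bodyFun_add_le (hm : 2 ≤ m)
    (h : ∀ s t : Fin (m + 1) → ℝ,
      bodyFun a₁ a₂ b₁ b₂ (s + t) ≤ bodyFun a₁ a₂ b₁ b₂ s + bodyFun a₁ a₂ b₁ b₂ t) :
    a₁ ≤ a₂ ∧ b₁ ≤ b₂ := by
  let p : Fin (m + 1) := ⟨0, by omega⟩
  let q : Fin (m + 1) := ⟨1, by omega⟩
  let r : Fin (m + 1) := ⟨2, by omega⟩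
  have hpq : p ≠ q := by simp [p, q]
  have hpr : p ≠ r := by simp [p, r]
  have hqr : q ≠ r := by simp [q, r]
  have hs (k : Fin (m + 1)) : 0 ≤ (1 - Pi.single r 1 : Fin (m + 1) → ℝ) k ∧
      (1 - Pi.single r 1 : Fin (m + 1) → ℝ) k ≤ 1 := by
    by_cases hk : k = r
    · subst hk; simp
    · simp [hk]
  have ht (k : Fin (m + 1)) : 0 ≤ (Pi.single p 1 + Pi.single r 1 : Fin (m + 1) → ℝ) k ∧
      (Pi.single p 1 + Pi.single r 1 : Fin (m + 1) → ℝ) k ≤ 1 := by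
    by_cases hk : k = r
    · subst hk; simp [hpr.symm]
    · by_cases hk' : k = p
      · subst hk'; simp [hk]
      · simp [hk, hk']
  have hst : (1 - Pi.single r 1 + (Pi.single p 1 + Pi.single r 1) : Fin (m + 1) → ℝ) =
      1 + Pi.single p 1 := by abel
  have hu (k : Fin (m + 1)) : 1 ≤ (1 + Pi.single p 1 : Fin (m + 1) → ℝ) k ∧
      (1 + Pi.single p 1 : Fin (m + 1) → ℝ) k ≤ 2 := by
    by_cases hk : k = p
    · subst hk; simp; norm_num
    · simp [hk]
  have es0 : (1 - Pi.single r 1 : Fin (m + 1) → ℝ) r = 0 := by simp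
  have es1 : (1 - Pi.single r 1 : Fin (m + 1) → ℝ) p = 1 := by simp [hpr]
  have et0 : (Pi.single p 1 + Pi.single r 1 : Fin (m + 1) → ℝ) q = 0 := by simp [hpq.symm, hqr]
  have et1 : (Pi.single p 1 + Pi.single r 1 : Fin (m + 1) → ℝ) p = 1 := by simp [hpr]
  have eu1 : (1 + Pi.single p 1 : Fin (m + 1) → ℝ) q = 1 := by simp [hpq.symm]
  have eu2 : (1 + Pi.single p 1 : Fin (m + 1) → ℝ) p = 2 := by simp; norm_num
  constructor
  · have h1 := h (1 - Pi.single r 1) (Pi.single p 1 + Pi.single r 1)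
    rw [hst, bodyFun_eq_of_bounds (i := p) (j := q) (fun k => by rw [eu2]; exact (hu k).2)
        fun k => by rw [eu1]; exact (hu k).1,
      bodyFun_eq_of_bounds (i := p) (j := r) (fun k => by rw [es1]; exact (hs k).2)
        fun k => by rw [es0]; exact (hs k).1,
      bodyFun_eq_of_bounds (i := p) (j := q) (fun k => by rw [et1]; exact (ht k).2)
        fun k => by rw [et0]; exact (ht k).1, es0, es1, et0, et1, eu1, eu2] at h1
    norm_num at h1
    linarith
  · have h1 := h (-(1 - Pi.single r 1)) (-(Pi.single p 1 + Pi.single r 1))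
    rw [← neg_add, hst,
      bodyFun_eq_of_bounds (i := q) (j := p)
        (fun k => by rw [Pi.neg_apply, Pi.neg_apply, eu1]; exact neg_le_neg (hu k).1)
        fun k => by rw [Pi.neg_apply, Pi.neg_apply, eu2]; exact neg_le_neg (hu k).2,
      bodyFun_eq_of_bounds (i := r) (j := p)
        (fun k => by rw [Pi.neg_apply, Pi.neg_apply, es0]; exact neg_le_neg (hs k).1)
        fun k => by rw [Pi.neg_apply, Pi.neg_apply, es1]; exact neg_le_neg (hs k).2,
      bodyFun_eq_of_bounds (i := q) (j := p)
        (fun k => by rw [Pi.neg_apply, Pi.neg_apply, et0]; exact neg_le_neg (ht k).1)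
        fun k => by rw [Pi.neg_apply, Pi.neg_apply, et1]; exact neg_le_neg (ht k).2,
      Pi.neg_apply, Pi.neg_apply, Pi.neg_apply, Pi.neg_apply, Pi.neg_apply, Pi.neg_apply,
      es0, es1, et0, et1, eu1, eu2] at h1
    norm_num at h1
    linarith

lemma IsCovariantValuation.exists_hasForm {n : ℕ} {Z : Set (Euc n) → Set (Euc n)}
    (hZ : IsCovariantValuation Z) (hn : 3 ≤ n) :
    ∃ a₁ a₂ b₁ b₂ c₁ c₂ : ℝ, 0 ≤ a₁ ∧ 0 ≤ a₂ ∧ 0 ≤ b₁ ∧ 0 ≤ b₂ ∧ 0 ≤ c₁ ∧ 0 ≤ c₂ ∧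
      a₁ ≤ a₂ ∧ b₁ ≤ b₂ ∧ a₂ - a₁ ≤ b₂ ∧ b₂ - b₁ ≤ a₂ ∧ HasForm Z a₁ a₂ b₁ b₂ c₁ c₂ := by
  obtain ⟨m, rfl⟩ : ∃ m, n = m + 1 := ⟨n - 1, by omega⟩
  have hm : 2 ≤ m := by omega
  obtain ⟨a₁, a₂, b₁, b₂, ha₁, ha₂, hb₁, hb₂, hab, hba, hlow⟩ := hZ.exists_represents_bodyFun hn
  obtain ⟨G, hG⟩ := hZ.exists_representsTop (by omega)
  have hsub : ∀ δ, 0 < δ → IsSublinear (G δ) := fun δ hδ => hG.isSublinear hZ (by omega) hδ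
  have hcut : IsTopCut G a₁ a₂ b₁ b₂ := fun δ s i j τ hδ hij hτ hτ1 => by
    have h1 := hG.cut (hlow m (by omega) (by omega)) hZ (by omega) hδ s hij hτ hτ1
    have h2 := bodyFun_update_self (a₁ := a₁) (a₂ := a₂) (b₁ := b₁) (b₂ := b₂) (s := s) hij
      hτ.le hτ1.le
    linarith
  have hlin := hcut.linear hsub hm
  have hle := le_of_bodyFun_add_le hm (bodyFun_add_le_of_linear hsub hlin)
  have havg := hcut.isEdgeAverage hsub hm
  obtain ⟨M, hM, hMrep, hMpos, hMneg⟩ := exists_momentFun m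
  let e : (Fin (m + 1) → ℝ) → ℝ := fun s => G 1 s - bodyFun a₁ a₂ b₁ b₂ s
  have hnonneg (c : ℝ) : 0 ≤ e (Pi.single 0 c) := by
    refine (hcut.of_eq hsub (i := ⟨1, by omega⟩) (j := ⟨2, by omega⟩) (by simp) ?_).1
    rw [Pi.single_eq_of_ne (by simp [Fin.ext_iff]), Pi.single_eq_of_ne (by simp [Fin.ext_iff])]
  let c₁ := e (Pi.single 0 1) / M (Pi.single 0 1)
  let c₂ := e (Pi.single 0 (-1)) / M (Pi.single 0 1)
  have he (s : Fin (m + 1) → ℝ) : e s = c₁ * M s + c₂ * M (-s) := by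
    have := ((havg.sub_const_mul hM c₁).sub_const_mul hM.comp_neg c₂).eq_zero 0 ?_ ?_ s
    · simp only [e]
      linarith
    · rw [← Pi.single_neg, hMneg]
      simp only [c₁, e]
      field_simp
      ring
    · rw [← Pi.single_neg, neg_neg, hMneg]
      simp only [c₂, e]
      field_simp
      ring
  refine ⟨a₁, a₂, b₁, b₂, c₁, c₂, ha₁, ha₂, hb₁, hb₂, div_nonneg (hnonneg _) hMpos.le,
    div_nonneg (hnonneg _) hMpos.le, hle.1, hle.2, hab, hba, fun d v hd hv x => ?_⟩
  rcases hv.le_dim.lt_or_eq with hdn | rfl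
  · rw [hlow d hd hdn v hv, mMinus1_eq, mPlus1_simplexOf_of_lt hdn, mPlus1_simplexOf_of_lt hdn]
    ring
  have hpos (v : Fin (m + 1) → Euc (m + 1)) (hv : LinearIndependent ℝ v)
      (hdet : 0 < (colMatrix v).det) : supp (Z (simplexOf v)) x =
        c₁ * mPlus1 (simplexOf v) x + c₂ * mMinus1 (simplexOf v) x +
          bodyFun a₁ a₂ b₁ b₂ fun i => ⟪x, v i⟫ := by
    have h1 := hlin (fun i => ⟪x, v i⟫) _ hdet
    have h2 := he fun i => ⟪x, v i⟫
    have h3 : (fun i => ⟪-x, v i⟫) = -fun i => ⟪x, v i⟫ := by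
      ext i
      simp
    rw [hG v hv hdet, mMinus1_eq, hMrep v hv, hMrep v hv, abs_of_pos hdet, h3]
    simp only [e] at h2
    rw [h2] at h1
    linarith
  rcases (det_colMatrix_ne_zero hv).lt_or_gt with hneg | hdet
  · have hij : (⟨0, by omega⟩ : Fin (m + 1)) ≠ ⟨1, by omega⟩ := by simp
    have := hpos (v ∘ Equiv.swap _ _) (hv.comp _ (Equiv.injective _))
      (by rw [det_colMatrix_swap v hij]; linarith)
    rw [simplexOf_comp_perm] at this
    rw [this]
    congr 1
    exact bodyFun_comp_perm (fun i => ⟪x, v i⟫) _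
  · exact hpos v hv hdet

end FullDimensional

/-- Theorem 1.5: for `n ≥ 3`, a map `Z : T_o^n → K_o^n` is an `SL(n)` covariant Minkowski
valuation iff there are constants `a₁,a₂,b₁,b₂,c₁,c₂ ≥ 0` with `a₁ ≤ a₂`, `b₁ ≤ b₂`,
`a₂-a₁ ≤ b₂`, `b₂-b₁ ≤ a₂`, such that `Z T = c₁ M⁺T + c₂ M⁻T + D_{a₁,a₂,b₁,b₂} T` for every
`T ∈ T_o^n` (stated via support functions), where `D T` is `Dbody` for `d ≥ 2` and
`[-b₁ v₁, a₁ v₁]` for `d = 1`. -/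
theorem sln_covariant_Minkowski_classification_simplices (n : ℕ) (hn : 3 ≤ n)
    (Z : Set (Euc n) → Set (Euc n))
    (hbody : ∀ T : Set (Euc n), IsSimplex0 T → IsConvexBody0 (Z T)) :
    ((∀ K L : Set (Euc n), IsSimplex0 K → IsSimplex0 L → IsSimplex0 (K ∪ L) →
        IsSimplex0 (K ∩ L) → Z (K ∪ L) + Z (K ∩ L) = Z K + Z L) ∧
      (∀ (φ : Matrix.SpecialLinearGroup (Fin n) ℝ) (T : Set (Euc n)), IsSimplex0 T →
        Z (matAct (φ : Matrix (Fin n) (Fin n) ℝ) T)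
          = matAct (φ : Matrix (Fin n) (Fin n) ℝ) (Z T))) ↔
      ∃ a₁ a₂ b₁ b₂ c₁ c₂ : ℝ,
        0 ≤ a₁ ∧ 0 ≤ a₂ ∧ 0 ≤ b₁ ∧ 0 ≤ b₂ ∧ 0 ≤ c₁ ∧ 0 ≤ c₂ ∧
        a₁ ≤ a₂ ∧ b₁ ≤ b₂ ∧ a₂ - a₁ ≤ b₂ ∧ b₂ - b₁ ≤ a₂ ∧
        (∀ (d : ℕ) (v : Fin d → Euc n), 2 ≤ d → d ≤ n →
          AffineIndependent ℝ (Fin.cons (0 : Euc n) v : Fin (d + 1) → Euc n) →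
          ∀ x : Euc n, supp (Z (simplexOf v)) x
            = c₁ * mPlus1 (simplexOf v) x + c₂ * mMinus1 (simplexOf v) x
              + supp (Dbody a₁ a₂ b₁ b₂ v) x) ∧
        (∀ v₁ : Euc n, v₁ ≠ 0 →
          ∀ x : Euc n, supp (Z (convexHull ℝ {0, v₁})) x
            = c₁ * mPlus1 (convexHull ℝ {0, v₁}) x + c₂ * mMinus1 (convexHull ℝ {0, v₁}) x
              + supp (convexHull ℝ {-b₁ • v₁, a₁ • v₁}) x) := by
  constructor
  · rintro ⟨hval, hcov⟩
    obtain ⟨a₁, a₂, b₁, b₂, c₁, c₂, h1, h2, h3, h4, hc1, hc2, h5, h6, h7, h8, h⟩ :=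
      IsCovariantValuation.exists_hasForm ⟨hbody, hval, hcov⟩ hn
    exact ⟨a₁, a₂, b₁, b₂, c₁, c₂, h1, h2, h3, h4, hc1, hc2, h5, h6, h7, h8,
      (hasForm_iff h1 h3 h5 h6 h7 h8).1 h⟩
  · rintro ⟨a₁, a₂, b₁, b₂, c₁, c₂, h1, -, h3, -, -, -, h5, h6, h7, h8, h⟩
    have h := (hasForm_iff h1 h3 h5 h6 h7 h8).2 h
    exact ⟨fun K L hK hL hKL hKL' => h.valuation hbody hK hL hKL hKL',
      fun φ T hT => h.covariant hbody φ hT⟩
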